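/- arXiv:1807.06034 — 7 statements merged into one kernel-verified Lean document; each statement's English description precedes it below -/
import Mathlib

section
/- Let G be a nonempty finite connected simple graph, let T be a (possibly infinite) tree, and let π : T → G be a covering map. Then the supremum of f_T(x) = 2∑_{{u,v}∈E(T)} x_u x_v over all finitely supported x : V(T) → ℝ with ∑_v x_v² = 1 equals λ₁(G) if and only if G contains at most one cycle (equivalently, since G is connected, if and only if |E(G)| ≤ |V(G)|, i.e. the average degree of G is at most 2). -/
open SimpleGraph

/-- A covering map of simple graphs: a graph homomorphism that is a local bijection on
neighbourhoods. -/
def IsGraphCover {α β : Type*} {T : SimpleGraph α} {G : SimpleGraph β} (π : T →g G) : Prop :=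
  ∀ v : α, Set.BijOn π (T.neighborSet v) (G.neighborSet (π v))

/-- The cycles of a graph, identified with their edge sets. -/
def cycleSets {α : Type*} (G : SimpleGraph α) : Set (Set (Sym2 α)) :=
  {s | ∃ (v : α) (w : G.Walk v v), w.IsCycle ∧ s = {e | e ∈ w.edges}}

open scoped Classical in
/-- `f_H(x) = 2 ∑_{{u,v} ∈ E(H)} x_u x_v` for a finitely supported `x`, written as a sum
over ordered pairs of adjacent vertices (each edge contributes twice). -/
noncomputable def quadForm {α : Type*} (H : SimpleGraph α) (x : α →₀ ℝ) : ℝ :=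
  ∑ u ∈ x.support, ∑ v ∈ x.support, if H.Adj u v then x u * x v else 0

lemma adjMatrix_isHermitian {β : Type*} [Fintype β] [DecidableEq β]
    (G : SimpleGraph β) [DecidableRel G.Adj] : (G.adjMatrix ℝ).IsHermitian := by
  rw [Matrix.IsHermitian, Matrix.conjTranspose_eq_transpose_of_trivial]
  exact G.isSymm_adjMatrix

/-- `λ₁(G)`: the largest eigenvalue of the adjacency matrix of the finite graph `G`. -/
noncomputable def lambdaOne {β : Type*} [Fintype β] [DecidableEq β] [Nonempty β]
    (G : SimpleGraph β) [DecidableRel G.Adj] : ℝ :=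
  ⨆ i, (adjMatrix_isHermitian G).eigenvalues i

/-- In a tree rooted at `r`, sending every vertex to its neighbour closest to `r` gives a parent
function which covers every edge. -/
lemma SimpleGraph.IsTree.exists_parent {V : Type*} {T : SimpleGraph V} (hT : T.IsTree) (r : V) :
    ∃ p : V → V, p r = r ∧ (∀ v, v ≠ r → T.Adj v (p v) ∧ T.dist r (p v) < T.dist r v) ∧
      ∀ u v, T.Adj u v → p u = v ∨ p v = u := by
  choose P hP hlen using fun v ↦ hT.connected.exists_path_of_dist v r
  have key : ∀ u v, T.Adj u v → T.dist r u = T.dist r v + 1 → (P u).snd = v := by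
    intro u v huv hd
    by_cases hv : v ∈ (P u).support
    · exact (hT.isAcyclic.eq_snd_of_adj_start (hP u) huv hv).symm
    · have hpath : (Walk.cons huv.symm (P u)).IsPath := (hP u).cons hv
      have heq := congrArg Walk.length
        (congrArg Subtype.val ((hT.isAcyclic.subsingleton_path v r).elim ⟨_, hpath⟩ ⟨P v, hP v⟩))
      simp only [Walk.length_cons, hlen] at heq
      rw [T.dist_comm, T.dist_comm (v := r)] at heq
      omega
  refine ⟨fun v ↦ (P v).snd, ?_, fun v hv ↦ ?_, fun u v huv ↦ ?_⟩
  · have hnil : (P r).Nil := by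
      rw [← Walk.length_eq_zero_iff, hlen, T.dist_self]
    exact (hnil.eq_nil ▸ rfl : (P r).snd = r)
  · have hnil : ¬ (P v).Nil := fun h ↦ hv h.eq
    refine ⟨(P v).adj_snd hnil, ?_⟩
    have h1 := (P v).length_tail_add_one hnil
    have h2 := T.dist_le (P v).tail
    rw [hlen, T.dist_comm] at h1
    rw [T.dist_comm] at h2
    dsimp only
    omega
  · rcases hT.dist_eq_dist_add_one_of_adj r huv with h | h
    · exact Or.inl (key u v huv h)
    · exact Or.inr (key v u huv.symm h)

/-- A connected graph with at most one cycle is a functional graph: its edges all have the form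
`{v, s v}` for some self-map `s`. -/
lemma exists_selfMap_of_cycleSets_subsingleton {V : Type*} {G : SimpleGraph V} (hG : G.Connected)
    (h : (cycleSets G).Subsingleton) :
    ∃ s : V → V, (∀ v, s v = v ∨ G.Adj v (s v)) ∧ ∀ u v, G.Adj u v → s u = v ∨ s v = u := by
  classical
  by_cases hac : G.IsAcyclic
  · obtain ⟨r⟩ := hG.nonempty
    obtain ⟨p, hr, hp, hadj⟩ := (IsTree.mk hG hac).exists_parent r
    refine ⟨p, fun v ↦ ?_, hadj⟩
    by_cases hv : v = r
    · exact Or.inl (hv ▸ hr)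
    · exact Or.inr (hp v hv).1
  · simp only [IsAcyclic, not_forall, not_not] at hac
    obtain ⟨w, c, hc⟩ := hac
    obtain ⟨e, he⟩ := List.exists_mem_of_ne_nil c.edges
      (by simpa using hc.ne_nil)
    induction e with | h a b =>
    have hab : G.Adj a b := c.adj_of_mem_edges he
    have hbr : ¬ G.IsBridge s(a, b) := fun hb ↦ hb.notMem_edges_of_isCycle hc he
    have hH : (G.deleteEdges {s(a, b)}).IsTree := by
      refine ⟨hG.connected_delete_edge_of_not_isBridge hbr, fun v d hd ↦ ?_⟩
      have hle : G.deleteEdges {s(a, b)} ≤ G := deleteEdges_le _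
      have heq := h ⟨w, c, hc, rfl⟩ ⟨v, d.mapLe hle, hd.mapLe hle, rfl⟩
      have hmem : s(a, b) ∈ (d.mapLe hle).edges := by
        have : s(a, b) ∈ {e | e ∈ c.edges} := he
        rw [heq] at this
        exact this
      rw [Walk.edges_mapLe_eq_edges] at hmem
      simpa using d.edges_subset_edgeSet hmem
    obtain ⟨p, hr, hp, hadj⟩ := hH.exists_parent a
    refine ⟨Function.update p a b, fun v ↦ ?_, fun u v huv ↦ ?_⟩
    · by_cases hv : v = a
      · subst hv
        simpa using Or.inr hab
      · rw [Function.update_of_ne hv]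
        exact Or.inr (deleteEdges_le _ (hp v hv).1)
    · by_cases he : s(u, v) = s(a, b)
      · rcases Sym2.eq_iff.1 he with ⟨rfl, rfl⟩ | ⟨rfl, rfl⟩ <;> simp
      · have huv' : (G.deleteEdges {s(a, b)}).Adj u v := by simp [huv, he]
        have hne : ∀ x y, (G.deleteEdges {s(a, b)}).Adj x y → p x = y →
            Function.update p a b x = y := by
          intro x y hxy hpx
          have : x ≠ a := fun hx ↦ hxy.ne (by rw [← hpx, hx, hr])
          rw [Function.update_of_ne this, hpx]
        exact (hadj u v huv').imp (hne u v huv') (hne v u huv'.symm)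

/-- A finite connected graph with two different cycles has more edges than vertices. -/
lemma card_lt_card_edgeFinset_of_not_subsingleton {V : Type*} [Fintype V] [DecidableEq V]
    {G : SimpleGraph V} [DecidableRel G.Adj] (hG : G.Connected)
    (h : ¬ (cycleSets G).Subsingleton) : Fintype.card V < G.edgeFinset.card := by
  rw [Set.not_subsingleton_iff] at h
  have key : ∃ (v w : V) (c : G.Walk v v) (d : G.Walk w w) (e : Sym2 V),
      c.IsCycle ∧ d.IsCycle ∧ e ∈ c.edges ∧ e ∉ d.edges := by
    obtain ⟨_, ⟨v, c, hc, rfl⟩, _, ⟨w, d, hd, rfl⟩, hne⟩ := h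
    by_contra! hcon
    exact hne (Set.Subset.antisymm (fun e he ↦ hcon v w c d e hc hd he)
      fun e he ↦ hcon w v d c e hd hc he)
  obtain ⟨v, w, c, d, e, hc, hd, hec, hed⟩ := key
  induction e with | h a b =>
  have hbr : ¬ G.IsBridge s(a, b) := fun hb ↦ hb.notMem_edges_of_isCycle hc hec
  have hcon := hG.connected_delete_edge_of_not_isBridge hbr
  have hnt : ¬ (G.deleteEdges {s(a, b)}).IsTree := fun ht ↦
    ht.isAcyclic _ (hd.toDeleteEdges G {s(a, b)} (by rintro e he rfl; exact hed he))
  have h1 := hcon.card_vert_le_card_edgeSet_add_one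
  have h2 : Nat.card (G.deleteEdges {s(a, b)}).edgeSet + 1 ≠ Nat.card V := fun heq ↦
    hnt (isTree_iff_connected_and_card.2 ⟨hcon, heq⟩)
  have h3 : (G.deleteEdges {s(a, b)}).edgeFinset.card < G.edgeFinset.card := by
    refine Finset.card_lt_card (Finset.ssubset_iff_of_subset ?_ |>.2 ⟨s(a, b), ?_, ?_⟩)
    · exact edgeFinset_mono (deleteEdges_le _)
    · exact mem_edgeFinset.2 (c.edges_subset_edgeSet hec)
    · simp
  rw [Nat.card_eq_fintype_card, Nat.card_eq_fintype_card, ← edgeFinset_card] at h1 h2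
  omega

/-- The Poisson equation on a finite connected graph is solvable for data of total mass zero. -/
lemma exists_lapMatrix_mulVec_eq {V : Type*} [Fintype V] [DecidableEq V]
    {G : SimpleGraph V} [DecidableRel G.Adj] (hG : G.Connected) (b : V → ℝ)
    (hb : ∑ v, b v = 0) : ∃ g : V → ℝ, (G.lapMatrix ℝ).mulVec g = b := by
  have := hG.nonempty
  have hcard : (Fintype.card V : ℝ) ≠ 0 := by simp
  have hsum : ∀ g : V → ℝ, ∑ v, (G.lapMatrix ℝ).mulVec g v = 0 := by
    intro g
    have h := Matrix.dotProduct_mulVec (fun _ ↦ (1 : ℝ)) (G.lapMatrix ℝ) g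
    rw [← Matrix.mulVec_transpose, (G.isSymm_lapMatrix (R := ℝ)).eq, lapMatrix_mulVec_const_eq_zero,
      zero_dotProduct] at h
    simpa [dotProduct] using h
  let L : (V → ℝ) →ₗ[ℝ] (V → ℝ) :=
    (G.lapMatrix ℝ).mulVecLin + LinearMap.pi fun _ ↦ ∑ v, LinearMap.proj v
  have hL : ∀ g v, L g v = (G.lapMatrix ℝ).mulVec g v + ∑ w, g w := by
    intro g v; simp [L]
  have hLsum : ∀ g, ∑ v, L g v = Fintype.card V * ∑ w, g w := by
    intro g; simp [hL, Finset.sum_add_distrib, hsum]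
  have hinj : Function.Injective L := by
    rw [injective_iff_map_eq_zero]
    intro g hg
    have hg0 : ∑ w, g w = 0 := by
      have := hLsum g
      simpa [hg, hcard] using this
    have hlap : (G.lapMatrix ℝ).mulVec g = 0 := by
      ext v
      have := hL g v
      simpa [hg, hg0] using this.symm
    rw [lapMatrix_mulVec_eq_zero_iff_forall_reachable] at hlap
    ext v
    have : ∑ w, g w = Fintype.card V * g v := by
      rw [Finset.sum_congr rfl fun w _ ↦ hlap w v (hG w v)]
      simp
    rw [hg0] at this
    simpa [hcard] using this.symm
  obtain ⟨g, hg⟩ := LinearMap.injective_iff_surjective.1 hinj b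
  refine ⟨g, ?_⟩
  have hg0 : ∑ w, g w = 0 := by
    have := hLsum g
    rw [hg, hb] at this
    simpa [hcard] using this.symm
  ext v
  rw [← hg, hL, hg0, add_zero]

/-- The adjacency matrix of a finite connected graph has a positive eigenvector for its largest
eigenvalue. -/
lemma exists_pos_eigenvector_lambdaOne {V : Type*} [Fintype V] [DecidableEq V] [Nonempty V]
    {G : SimpleGraph V} [DecidableRel G.Adj] (hG : G.Connected) :
    ∃ φ : V → ℝ, (∀ v, 0 < φ v) ∧ ∀ v, ∑ w ∈ G.neighborFinset v, φ w = lambdaOne G * φ v := by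
  set hA := adjMatrix_isHermitian G
  have hle : ∀ i, hA.eigenvalues i ≤ lambdaOne G := fun i ↦
    le_ciSup (f := hA.eigenvalues) (Set.finite_range _).bddAbove i
  obtain ⟨i, hi⟩ : ∃ i, hA.eigenvalues i = lambdaOne G := exists_eq_ciSup_of_finite
  set B : Matrix V V ℝ := lambdaOne G • (1 : Matrix V V ℝ) - G.adjMatrix ℝ with hBdef
  have hBmul : ∀ x : V → ℝ, B.mulVec x = lambdaOne G • x - (G.adjMatrix ℝ).mulVec x := by
    intro x; simp [hBdef, Matrix.sub_mulVec, Matrix.smul_mulVec]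
  have hBh : B.IsHermitian := by
    refine Matrix.IsHermitian.sub ?_ hA
    simp [Matrix.IsHermitian]
  have hB : B.PosSemidef := by
    rw [hBh.posSemidef_iff_eigenvalues_nonneg]
    intro j
    have hj := hBh.eigenvalues_mem_spectrum_real j
    generalize hBh.eigenvalues j = ν at hj ⊢
    rw [hBdef, ← Algebra.algebraMap_eq_smul_one, ← spectrum.singleton_sub_eq,
      hA.spectrum_real_eq_range_eigenvalues] at hj
    obtain ⟨_, rfl, _, ⟨k, rfl⟩, hk⟩ := hj
    rw [Pi.zero_apply, ← hk]
    exact sub_nonneg.2 (hle k)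
  set x : V → ℝ := ⇑(hA.eigenvectorBasis i) with hx
  have hAx : (G.adjMatrix ℝ).mulVec x = lambdaOne G • x := by
    rw [hx, hA.mulVec_eigenvectorBasis i, hi]
  have hx0 : x ≠ 0 := by
    intro h0
    have := hA.eigenvectorBasis.orthonormal.ne_zero i
    exact this (by ext v; exact congrFun h0 v)
  have hzero : B.mulVec |x| = 0 := by
    have h0 : star x ⬝ᵥ B.mulVec x = 0 := by rw [hBmul, hAx]; simp
    have h1 : star |x| ⬝ᵥ B.mulVec |x| ≤ star x ⬝ᵥ B.mulVec x := by
      rw [hBmul, hBmul]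
      simp only [star_trivial, dotProduct, Pi.sub_apply, Pi.smul_apply, smul_eq_mul,
        Pi.abs_apply, Matrix.mulVec, Finset.mul_sum, mul_sub]
      refine Finset.sum_le_sum fun u _ ↦ sub_le_sub ?_ (Finset.sum_le_sum fun v _ ↦ ?_)
      · rw [mul_left_comm, abs_mul_abs_self, mul_left_comm]
      · rw [adjMatrix_apply]
        split_ifs
        · rw [one_mul, one_mul, ← abs_mul]; exact le_abs_self _
        · simp
    exact (hB.dotProduct_mulVec_zero_iff _).1 (le_antisymm (h1.trans h0.le) (hB.dotProduct_mulVec_nonneg _))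
  have heig : ∀ v, ∑ w ∈ G.neighborFinset v, |x w| = lambdaOne G * |x v| := by
    intro v
    have := congrFun hzero v
    rw [hBmul] at this
    simp only [Pi.sub_apply, adjMatrix_mulVec_apply, Pi.smul_apply, smul_eq_mul, Pi.abs_apply,
      Pi.zero_apply] at this
    linarith
  refine ⟨fun v ↦ |x v|, fun v ↦ abs_pos.2 fun hv ↦ hx0 ?_, heig⟩
  have hstep : ∀ u w, G.Adj u w → x u = 0 → x w = 0 := by
    intro u w huw hu
    have := heig u
    rw [hu, abs_zero, mul_zero, Finset.sum_eq_zero_iff_of_nonneg fun _ _ ↦ abs_nonneg _] at this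
    exact abs_eq_zero.1 (this w (by simpa using huw))
  ext w
  obtain ⟨p⟩ := hG v w
  induction p with
  | nil => exact hv
  | cons h _ ih => exact ih (hstep _ _ h hv)

/-- Divergence data on a graph with more edges than vertices: a function on ordered pairs which
strictly increases under the non-backtracking transfer operator. -/
lemma exists_pairWeight {V : Type*} [Fintype V] [DecidableEq V]
    {G : SimpleGraph V} [DecidableRel G.Adj] (hG : G.Connected)
    (h : Fintype.card V < G.edgeFinset.card) :
    ∃ y : V → V → ℝ, (∀ u, 1 ≤ ∑ v ∈ G.neighborFinset u, y u v) ∧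
      ∀ u p, y p u + 1 ≤ ∑ v ∈ G.neighborFinset u, y u v - y u p := by
  set n : ℝ := (Fintype.card V : ℝ)
  set m : ℝ := (G.edgeFinset.card : ℝ)
  have hnm : n + 1 ≤ m := by
    simp only [n, m]; exact_mod_cast h
  have hn : 0 ≤ n := Nat.cast_nonneg _
  have hdeg : ∑ v, (G.degree v : ℝ) = 2 * m := by
    simp only [m]; exact_mod_cast G.sum_degrees_eq_twice_card_edges
  obtain ⟨g, hg⟩ := exists_lapMatrix_mulVec_eq hG (fun v ↦ m - G.degree v * (n / 2)) (by
    rw [Finset.sum_sub_distrib, ← Finset.sum_mul, hdeg]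
    simp only [Finset.sum_const, Finset.card_univ, nsmul_eq_mul]
    ring)
  have hsum : ∀ u, ∑ v ∈ G.neighborFinset u, (n / 2 + g u - g v) = m := by
    intro u
    have := congrFun hg u
    rw [lapMatrix_mulVec_apply] at this
    rw [Finset.sum_sub_distrib, Finset.sum_const, card_neighborFinset_eq_degree, nsmul_eq_mul]
    linarith
  refine ⟨fun u v ↦ n / 2 + g u - g v, fun u ↦ ?_, fun u p ↦ ?_⟩
  · rw [hsum]; linarith
  · rw [hsum]; linarith

/-- On a graph with more edges than vertices, a positive eigenfunction can be reweighted along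
directed edges so that non-backtracking growth is strictly slower than the eigenvalue. -/
lemma exists_edgeWeight {V : Type*} [Fintype V] [DecidableEq V]
    {G : SimpleGraph V} [DecidableRel G.Adj] (hG : G.Connected)
    (h : Fintype.card V < G.edgeFinset.card) {φ : V → ℝ} {l : ℝ} (hφ : ∀ v, 0 < φ v)
    (heig : ∀ v, ∑ w ∈ G.neighborFinset v, φ w = l * φ v) :
    ∃ t : V → V → ℝ, ∃ μ < l, (∀ u v, 0 < t u v) ∧
      (∀ u, ∑ v ∈ G.neighborFinset u, φ v * t u v ≤ μ * φ u) ∧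
      ∀ u p, ∑ v ∈ G.neighborFinset u, φ v * t u v - φ p * t u p + φ p / t p u ≤ μ * φ u := by
  obtain ⟨y, hy1, hy2⟩ := exists_pairWeight hG h
  obtain ⟨M₀, hM₀⟩ := (Set.finite_range φ).bddAbove
  obtain ⟨S₀, hS₀⟩ := (Set.finite_range fun q : V × V ↦ |y q.1 q.2 / (φ q.1 * φ q.2)|).bddAbove
  set M := max M₀ 1
  set S := max S₀ 1
  have hM1 : 1 ≤ M := le_max_right _ _
  have hS1 : 1 ≤ S := le_max_right _ _
  have hM : ∀ v, φ v ≤ M := fun v ↦ (hM₀ ⟨v, rfl⟩).trans (le_max_left _ _)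
  have hS : ∀ u v, |y u v / (φ u * φ v)| ≤ S := fun u v ↦
    (hS₀ ⟨(u, v), rfl⟩).trans (le_max_left _ _)
  set δ : ℝ := 1 / (4 * M ^ 2 * S ^ 2) with hδ
  have hδ0 : 0 < δ := by positivity
  have hδMS : 4 * δ * M ^ 2 * S ^ 2 = 1 := by rw [hδ]; field_simp
  have hw : ∀ u v, |δ * (y u v / (φ u * φ v))| ≤ δ * S := by
    intro u v
    rw [abs_mul, abs_of_pos hδ0]
    exact mul_le_mul_of_nonneg_left (hS u v) hδ0.le
  have hδS : δ * S ≤ 1 / 2 := by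
    have h1 : δ * S * 1 ≤ δ * S * (M ^ 2 * S) := by
      have : 1 ≤ M ^ 2 * S := one_le_mul_of_one_le_of_one_le (one_le_pow₀ hM1) hS1
      gcongr
    nlinarith
  have hsum : ∀ u, ∑ v ∈ G.neighborFinset u, φ v * (1 - δ * (y u v / (φ u * φ v))) =
      l * φ u - δ / φ u * ∑ v ∈ G.neighborFinset u, y u v := by
    intro u
    rw [← heig, Finset.mul_sum, ← Finset.sum_sub_distrib]
    refine Finset.sum_congr rfl fun v _ ↦ ?_
    have := (hφ u).ne'
    have := (hφ v).ne'
    field_simp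
  have hδφ : ∀ u, δ / M ≤ δ / φ u := fun u ↦ div_le_div_of_nonneg_left hδ0.le (hφ u) (hM u)
  have hη : ∀ u, l * φ u - δ / (2 * M) ≤ (l - δ / (2 * M ^ 2)) * φ u := by
    intro u
    have h1 : δ / (2 * M ^ 2) * φ u ≤ δ / (2 * M ^ 2) * M := by
      have := hM u
      gcongr
    have h2 : δ / (2 * M ^ 2) * M = δ / (2 * M) := by field_simp
    linarith
  have hhalf : δ / (2 * M) = δ / M / 2 := by field_simp
  have hδM : 0 < δ / M := by positivity
  have ht : ∀ u v, 0 < 1 - δ * (y u v / (φ u * φ v)) := by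
    intro u v
    have := (abs_le.1 ((hw u v).trans hδS)).2
    linarith
  refine ⟨fun u v ↦ 1 - δ * (y u v / (φ u * φ v)), l - δ / (2 * M ^ 2), ?_, ht, fun u ↦ ?_,
    fun u p ↦ ?_⟩
  · have : 0 < δ / (2 * M ^ 2) := by positivity
    linarith
  · refine le_trans ?_ (hη u)
    rw [hsum, hhalf]
    have := hδφ u
    nlinarith [hy1 u]
  · refine le_trans ?_ (hη u)
    rw [hsum, hhalf]
    set w := δ * (y p u / (φ p * φ u)) with hwdef
    have hwS : |w| ≤ δ * S := hw p u
    have hw2 := abs_le.1 (hwS.trans hδS)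
    have hinv : 1 / (1 - w) ≤ 1 + w + 2 * w ^ 2 := by
      rw [div_le_iff₀ (ht p u)]
      nlinarith [sq_nonneg w]
    have hfrac : φ p / (1 - w) ≤ φ p + δ / φ u * y p u + φ p * (2 * w ^ 2) := by
      have h1 : φ p * (1 / (1 - w)) ≤ φ p * (1 + w + 2 * w ^ 2) :=
        mul_le_mul_of_nonneg_left hinv (hφ p).le
      have h2 : φ p * w = δ / φ u * y p u := by
        rw [hwdef]
        have := (hφ u).ne'
        have := (hφ p).ne'
        field_simp
      rw [mul_one_div] at h1
      linarith
    have hquad : φ p * (2 * w ^ 2) ≤ δ / M / 2 := by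
      have h1 : w ^ 2 ≤ (δ * S) ^ 2 := by
        rw [← sq_abs]
        gcongr
      calc φ p * (2 * w ^ 2) ≤ M * (2 * (δ * S) ^ 2) := by
            have := hM p
            gcongr
        _ = δ / M / 2 * (4 * δ * M ^ 2 * S ^ 2) := by field_simp; ring
        _ = δ / M / 2 := by rw [hδMS, mul_one]
    have hback : φ p * (1 - δ * (y u p / (φ u * φ p))) = φ p - δ / φ u * y u p := by
      have := (hφ u).ne'
      have := (hφ p).ne'
      field_simp
    have hdiv : δ / φ u * (y p u + 1) ≤
        δ / φ u * (∑ v ∈ G.neighborFinset u, y u v - y u p) :=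
      mul_le_mul_of_nonneg_left (hy2 u p) (div_pos hδ0 (hφ u)).le
    have := hδφ u
    rw [hback]
    linarith

/-- A covering of a finite graph is locally finite. -/
noncomputable abbrev IsGraphCover.locallyFinite {α β : Type*} [Finite β] {T : SimpleGraph α}
    {G : SimpleGraph β} {π : T →g G} (hπ : IsGraphCover π) : T.LocallyFinite := fun v ↦
  (Set.Finite.of_injOn (hπ v).mapsTo (hπ v).injOn (Set.toFinite _)).fintype

/-- Neighbourhood sums of functions pulled back along a covering. -/
lemma IsGraphCover.sum_neighborFinset {α β : Type*} [Fintype β] {T : SimpleGraph α}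
    {G : SimpleGraph β} [DecidableRel G.Adj] [T.LocallyFinite] {π : T →g G} (hπ : IsGraphCover π)
    (F : β → ℝ) (u : α) :
    ∑ v ∈ T.neighborFinset u, F (π v) = ∑ w ∈ G.neighborFinset (π u), F w := by
  refine Finset.sum_nbij π (fun v hv ↦ ?_) ?_ ?_ fun _ _ ↦ rfl
  · rw [mem_neighborFinset] at hv ⊢
    exact π.map_adj hv
  · simpa using (hπ u).injOn
  · simpa using (hπ u).surjOn

/-- A weighted Schur test for the quadratic form of a graph. -/
lemma quadForm_le_of_weight {α : Type*} (H : SimpleGraph α) [H.LocallyFinite] {a : α → α → ℝ}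
    {μ : ℝ} (hpos : ∀ u v, 0 < a u v) (hmul : ∀ u v, H.Adj u v → a u v * a v u = 1)
    (hsum : ∀ u, ∑ v ∈ H.neighborFinset u, a u v ≤ μ) (x : α →₀ ℝ) :
    quadForm H x ≤ μ * ∑ v ∈ x.support, x v ^ 2 := by
  classical
  have hpt : ∀ u v, H.Adj u v → x u * x v ≤ (a u v * x u ^ 2 + a v u * x v ^ 2) / 2 := by
    intro u v huv
    have h1 := hmul u v huv
    have h2 := hpos u v
    have h3 : 0 ≤ a v u * (a u v * x u - x v) ^ 2 := by have := hpos v u; positivity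
    have h4 : a v u * (a u v * x u - x v) ^ 2 =
        (a u v * a v u) * a u v * x u ^ 2 - 2 * (a u v * a v u) * (x u * x v) +
          a v u * x v ^ 2 := by ring
    rw [h4, h1] at h3
    linarith
  have hswap : ∑ u ∈ x.support, ∑ v ∈ x.support, (if H.Adj u v then a v u * x v ^ 2 else 0) =
      ∑ u ∈ x.support, ∑ v ∈ x.support, (if H.Adj u v then a u v * x u ^ 2 else 0) := by
    rw [Finset.sum_comm]
    simp only [H.adj_comm]
  calc quadForm H x
      ≤ ∑ u ∈ x.support, ∑ v ∈ x.support,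
          ((if H.Adj u v then a u v * x u ^ 2 else 0) / 2 +
            (if H.Adj u v then a v u * x v ^ 2 else 0) / 2) := by
        unfold quadForm
        refine Finset.sum_le_sum fun u _ ↦ Finset.sum_le_sum fun v _ ↦ ?_
        split_ifs with h
        · have := hpt u v h
          linarith
        · simp
    _ = ∑ u ∈ x.support, ∑ v ∈ x.support, (if H.Adj u v then a u v * x u ^ 2 else 0) := by
        simp only [Finset.sum_add_distrib, ← Finset.sum_div]
        rw [hswap]
        ring
    _ ≤ ∑ u ∈ x.support, μ * x u ^ 2 := by
        refine Finset.sum_le_sum fun u _ ↦ ?_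
        rw [← Finset.sum_filter, ← Finset.sum_mul]
        refine mul_le_mul_of_nonneg_right (le_trans ?_ (hsum u)) (sq_nonneg _)
        refine Finset.sum_le_sum_of_subset_of_nonneg (fun v hv ↦ ?_) fun v _ _ ↦ (hpos u v).le
        simpa using (Finset.mem_filter.1 hv).2
    _ = μ * ∑ v ∈ x.support, x v ^ 2 := by rw [Finset.mul_sum]

/-- The quadratic form of the restriction of an eigenfunction to a finite set is the eigenvalue
times the mass of the restriction, up to a boundary term. -/
lemma exists_quadForm_eq_sub_boundary {α : Type*} [DecidableEq α] (H : SimpleGraph α)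
    [H.LocallyFinite] {ψ : α → ℝ} {l : ℝ} (hψ : ∀ v, 0 < ψ v)
    (heig : ∀ u, ∑ v ∈ H.neighborFinset u, ψ v = l * ψ u) (D : Finset α) :
    ∃ x : α →₀ ℝ, ∑ v ∈ x.support, x v ^ 2 = ∑ v ∈ D, ψ v ^ 2 ∧
      quadForm H x = l * ∑ v ∈ D, ψ v ^ 2 -
        ∑ u ∈ D, ∑ v ∈ H.neighborFinset u \ D, ψ u * ψ v := by
  classical
  let x : α →₀ ℝ := Finsupp.onFinset D (fun v ↦ if v ∈ D then ψ v else 0)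
    fun v hv ↦ by_contra fun h ↦ hv (if_neg h)
  have hx : ∀ v ∈ D, x v = ψ v := fun v hv ↦ by simp [x, hv]
  have hsupp : x.support = D := by
    ext v
    simp [x, (hψ v).ne']
  refine ⟨x, ?_, ?_⟩
  · rw [hsupp]
    exact Finset.sum_congr rfl fun v hv ↦ by rw [hx v hv]
  · unfold quadForm
    rw [hsupp, Finset.mul_sum, ← Finset.sum_sub_distrib]
    refine Finset.sum_congr rfl fun u hu ↦ ?_
    have h1 : ∑ v ∈ D, (if H.Adj u v then x u * x v else 0) =
        ∑ v ∈ H.neighborFinset u ∩ D, ψ u * ψ v := by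
      rw [← Finset.sum_filter]
      refine Finset.sum_congr ?_ fun v hv ↦ ?_
      · ext v
        simp [and_comm]
      · rw [hx u hu, hx v (Finset.mem_inter.1 hv).2]
    have h2 := Finset.sum_inter_add_sum_sdiff (H.neighborFinset u) D fun v ↦ ψ u * ψ v
    rw [← Finset.mul_sum (H.neighborFinset u) ψ (ψ u), heig] at h2
    rw [h1]
    linarith

/-- A tree covering a graph which is the graph of a self-map can be exhausted by finite sets with
uniformly bounded boundary. -/
lemma exists_finset_small_boundary {α β : Type*} [Fintype β] {T : SimpleGraph α}
    {G : SimpleGraph β} (hT : T.Connected) {π : T →g G} (hπ : IsGraphCover π) {s : β → β}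
    (hs : ∀ v, s v = v ∨ G.Adj v (s v)) (hadj : ∀ u v, G.Adj u v → s u = v ∨ s v = u)
    (F : Finset α) :
    ∃ (D : Finset α) (B : Finset (α × α)), F ⊆ D ∧ B.card ≤ Fintype.card β + 1 ∧
      ∀ u ∈ D, ∀ v, v ∉ D → T.Adj u v → (u, v) ∈ B := by
  classical
  have hlift : ∀ x, ∃ y, (y = x ∨ T.Adj x y) ∧ π y = s (π x) := by
    intro x
    rcases hs (π x) with h | h
    · exact ⟨x, Or.inl rfl, h.symm⟩
    · obtain ⟨y, hy, hyx⟩ := (hπ x).surjOn h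
      exact ⟨y, Or.inr hy, hyx⟩
  choose f hf hπf using hlift
  have hfadj : ∀ u v, T.Adj u v → s (π u) = π v → f u = v := by
    intro u v huv h
    have h' : π (f u) = π v := (hπf u).trans h
    rcases hf u with hu | hu
    · rw [hu] at h'
      exact absurd h' (π.map_adj huv).ne
    · exact (hπ u).injOn hu huv h'
  have hedge : ∀ u v, T.Adj u v → f u = v ∨ f v = u := fun u v huv ↦
    (hadj _ _ (π.map_adj huv)).imp (hfadj u v huv) (hfadj v u huv.symm)
  have hinj : ∀ w w', f w = f w' → π w = π w' → w = w' := by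
    intro w w' h h'
    have hloop : ∀ a b, π a = π b → f a = a → ¬ T.Adj b (f b) := by
      intro a b hab ha hb
      have h1 := hπf a
      rw [ha] at h1
      have h2 := π.map_adj hb
      rw [hπf, ← hab, ← h1] at h2
      exact h2.ne rfl
    rcases hf w with hw | hw <;> rcases hf w' with hw' | hw'
    · rw [← hw, ← hw', h]
    · exact absurd hw' (hloop w w' h' hw)
    · exact absurd hw (hloop w' w h'.symm hw')
    · rw [← h] at hw'
      exact (hπ (f w)).injOn hw.symm hw'.symm h'
  have hlayer : ∀ (x : α) (j : ℕ), Set.InjOn π {w | f^[j] w = x} := by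
    intro x j
    induction j with
    | zero => intro w hw w' hw' _; exact hw.trans (Eq.symm hw')
    | succ j ih =>
      intro w hw w' hw' h
      exact hinj w w' (ih hw hw' (by rw [hπf, hπf, h])) h
  have hfin : ∀ x j, {w | f^[j] w = x}.Finite := fun x j ↦
    Set.Finite.of_injOn (Set.mapsTo_univ _ _) (hlayer x j) Set.finite_univ
  obtain ⟨x₀⟩ := hT.nonempty
  let E : ℕ → Set α := fun k ↦ {w | ∃ i ≤ 2 * k, f^[i] w = f^[k] x₀}
  have hEmono : Monotone E := by
    refine monotone_nat_of_le_succ fun k w hw ↦ ?_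
    obtain ⟨i, hi, hw⟩ := hw
    exact ⟨i + 1, by omega, by rw [Function.iterate_succ_apply', hw, Function.iterate_succ_apply']⟩
  have hEfin : ∀ k, (E k).Finite := by
    intro k
    refine ((Set.finite_Iic (2 * k)).biUnion fun i _ ↦ hfin (f^[k] x₀) i).subset ?_
    rintro w ⟨i, hi, hw⟩
    exact Set.mem_biUnion (Set.mem_Iic.2 hi) hw
  have hEstep : ∀ u v k, T.Adj u v → u ∈ E k → v ∈ E (k + 1) := by
    rintro u v k huv ⟨i, hi, hu⟩
    rcases hedge u v huv with h | h
    · refine ⟨i, by omega, ?_⟩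
      rw [← h, ← Function.iterate_succ_apply, Function.iterate_succ_apply', hu,
        Function.iterate_succ_apply']
    · refine ⟨i + 2, by omega, ?_⟩
      rw [Function.iterate_succ_apply', Function.iterate_succ_apply, h, hu,
        Function.iterate_succ_apply']
  have hEwalk : ∀ a b, T.Walk a b → b ∈ E 0 → ∃ k, a ∈ E k := by
    intro a b p hb
    induction p with
    | nil => exact ⟨0, hb⟩
    | cons h _ ih =>
      obtain ⟨k, hk⟩ := ih hb
      exact ⟨k + 1, hEstep _ _ k h.symm hk⟩
  have hEall : ∀ w, ∃ k, w ∈ E k := by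
    intro w
    obtain ⟨p⟩ := hT w x₀
    exact hEwalk w x₀ p ⟨0, le_rfl, rfl⟩
  choose κ hκ using hEall
  set N := F.sup κ
  set x := f^[N] x₀
  refine ⟨(hEfin N).toFinset,
    insert (x, f x) ((hfin x (2 * N + 1)).toFinset.image fun v ↦ (f v, v)), ?_, ?_, ?_⟩
  · intro w hw
    rw [Set.Finite.mem_toFinset]
    exact hEmono (Finset.le_sup hw) (hκ w)
  · refine (Finset.card_insert_le _ _).trans (Nat.succ_le_succ (Finset.card_image_le.trans ?_))
    exact Finset.card_le_card_of_injOn π (fun _ _ ↦ Finset.mem_univ _)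
      (by simpa using hlayer x (2 * N + 1))
  · intro u hu v hv huv
    simp only [Set.Finite.mem_toFinset] at hu hv
    obtain ⟨i, hi, hu⟩ := hu
    rcases hedge u v huv with h | h
    · rcases i with _ | i
      · have hux : u = x := hu
        simp [← h, hux]
      · refine absurd ⟨i, by omega, ?_⟩ hv
        rw [← h, ← Function.iterate_succ_apply, hu]
    · have hvi : f^[i + 1] v = x := by rw [Function.iterate_succ_apply, h, hu]
      have hiN : i = 2 * N := by
        by_contra hne
        exact hv ⟨i + 1, by omega, hvi⟩
      subst hiN
      refine Finset.mem_insert_of_mem (Finset.mem_image.2 ⟨v, ?_, by rw [h]⟩)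
      simpa using hvi

/-- The eigenvalue of a positive finite-type eigenfunction on a tree covering a functional graph is
at most every upper bound of the quadratic form. -/
lemma le_of_quadForm_le {α β : Type*} [Fintype β] [Nonempty β] {T : SimpleGraph α}
    {G : SimpleGraph β} [DecidableRel G.Adj] (hT : T.Connected) {π : T →g G}
    (hπ : IsGraphCover π) {s : β → β}
    (hs : ∀ v, s v = v ∨ G.Adj v (s v)) (hadj : ∀ u v, G.Adj u v → s u = v ∨ s v = u)
    {φ : β → ℝ} {l : ℝ} (hφ : ∀ v, 0 < φ v)
    (heig : ∀ v, ∑ w ∈ G.neighborFinset v, φ w = l * φ v) {μ : ℝ}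
    (hμ : ∀ x : α →₀ ℝ, quadForm T x ≤ μ * ∑ v ∈ x.support, x v ^ 2) : l ≤ μ := by
  classical
  let _ := hπ.locallyFinite
  by_contra! hlt
  obtain ⟨M, hM⟩ := (Set.finite_range φ).bddAbove
  replace hM : ∀ v, φ v ≤ M := fun v ↦ hM ⟨v, rfl⟩
  obtain ⟨b₀, hb₀⟩ := Finite.exists_min φ
  have hc : 0 < φ b₀ := hφ b₀
  have hM0 : 0 < M := hc.trans_le (hM b₀)
  have hTeig : ∀ u, ∑ v ∈ T.neighborFinset u, φ (π v) = l * φ (π u) := fun u ↦ by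
    rw [hπ.sum_neighborFinset, heig]
  have hmass : ∀ D : Finset α, (l - μ) * ∑ v ∈ D, φ (π v) ^ 2 ≤
      ∑ u ∈ D, ∑ v ∈ T.neighborFinset u \ D, φ (π u) * φ (π v) := by
    intro D
    obtain ⟨x, hx1, hx2⟩ := exists_quadForm_eq_sub_boundary T (ψ := fun v ↦ φ (π v))
      (fun v ↦ hφ _) hTeig D
    have := hμ x
    rw [hx1, hx2] at this
    linarith
  have hlow : ∀ D : Finset α, (l - μ) * (D.card * φ b₀ ^ 2) ≤
      (l - μ) * ∑ v ∈ D, φ (π v) ^ 2 := by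
    intro D
    refine mul_le_mul_of_nonneg_left ?_ (sub_pos.2 hlt).le
    rw [← nsmul_eq_mul]
    exact Finset.card_nsmul_le_sum _ _ _ fun v _ ↦ pow_le_pow_left₀ hc.le (hb₀ _) 2
  rcases finite_or_infinite α with hα | hα
  · have := Fintype.ofFinite α
    obtain ⟨x₀⟩ := hT.nonempty
    have h1 := ((hlow Finset.univ).trans (hmass Finset.univ)).trans_eq
      (Finset.sum_eq_zero fun u _ ↦ by
        rw [Finset.sdiff_eq_empty_iff_subset.2 (Finset.subset_univ _), Finset.sum_empty])
    have h2 : 0 < (l - μ) * ((Finset.univ : Finset α).card * φ b₀ ^ 2) := by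
      have : 0 < (Finset.univ : Finset α).card := Finset.card_pos.2 ⟨x₀, Finset.mem_univ _⟩
      have := sub_pos.2 hlt
      positivity
    linarith
  · set K : ℝ := (Fintype.card β + 1) * (M * M)
    have hpos : 0 < (l - μ) * φ b₀ ^ 2 := mul_pos (sub_pos.2 hlt) (pow_pos hc 2)
    obtain ⟨n, hn⟩ := exists_nat_gt (K / ((l - μ) * φ b₀ ^ 2))
    obtain ⟨F, hF⟩ := Infinite.exists_subset_card_eq α n
    obtain ⟨D, B, hFD, hB, hDB⟩ := exists_finset_small_boundary hT hπ hs hadj F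
    have hbd : ∑ u ∈ D, ∑ v ∈ T.neighborFinset u \ D, φ (π u) * φ (π v) ≤ K := by
      rw [Finset.sum_sigma']
      set P := D.sigma fun u ↦ T.neighborFinset u \ D
      have hcard : P.card ≤ B.card := by
        refine Finset.card_le_card_of_injOn (fun q ↦ (q.1, q.2)) ?_ ?_
        · rintro ⟨u, v⟩ hq
          simp only [P, Finset.coe_sigma, Set.mem_sigma_iff, Finset.mem_coe, Finset.mem_sdiff,
            mem_neighborFinset] at hq
          exact hDB u hq.1 v hq.2.2 hq.2.1
        · rintro ⟨u, v⟩ _ ⟨u', v'⟩ _ h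
          simp only [Prod.mk.injEq] at h
          obtain ⟨rfl, rfl⟩ := h
          rfl
      calc ∑ q ∈ P, φ (π q.1) * φ (π q.2) ≤ P.card • (M * M) :=
            Finset.sum_le_card_nsmul _ _ _ fun q _ ↦
              mul_le_mul (hM _) (hM _) (hφ _).le hM0.le
        _ ≤ K := by
            rw [nsmul_eq_mul]
            have : (P.card : ℝ) ≤ Fintype.card β + 1 := by exact_mod_cast hcard.trans hB
            exact mul_le_mul_of_nonneg_right this (mul_pos hM0 hM0).le
    have h1 := ((hlow D).trans (hmass D)).trans hbd
    have h2 : (n : ℝ) ≤ D.card := by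
      rw [← hF]
      exact_mod_cast Finset.card_le_card hFD
    rw [div_lt_iff₀ hpos] at hn
    have h3 := mul_le_mul_of_nonneg_right h2 hpos.le
    linarith

/-- The quadratic form of a tree covering a graph with more edges than vertices is bounded strictly
below the eigenvalue of a positive eigenfunction of the base. -/
lemma exists_lt_quadForm_le {α β : Type*} [Fintype β] [DecidableEq β] {T : SimpleGraph α}
    {G : SimpleGraph β} [DecidableRel G.Adj] (hG : G.Connected)
    (h : Fintype.card β < G.edgeFinset.card) (hT : T.IsTree) {π : T →g G} (hπ : IsGraphCover π)
    {φ : β → ℝ} {l : ℝ} (hφ : ∀ v, 0 < φ v)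
    (heig : ∀ v, ∑ w ∈ G.neighborFinset v, φ w = l * φ v) :
    ∃ μ < l, ∀ x : α →₀ ℝ, quadForm T x ≤ μ * ∑ v ∈ x.support, x v ^ 2 := by
  classical
  let _ := hπ.locallyFinite
  obtain ⟨t, μ, hμ, ht, hroot, hstep⟩ := exists_edgeWeight hG h hφ heig
  obtain ⟨r⟩ := hT.connected.nonempty
  obtain ⟨p, hpr, hp, hadj⟩ := hT.exists_parent r
  have hanti : ∀ u v, T.Adj u v → p v = u → p u ≠ v := by
    intro u v huv hv hu
    by_cases hur : u = r
    · exact huv.ne (by rw [← hu, hur, hpr])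
    · by_cases hvr : v = r
      · exact huv.ne (by rw [← hv, hvr, hpr])
      · have h1 := (hp u hur).2
        have h2 := (hp v hvr).2
        rw [hu] at h1
        rw [hv] at h2
        omega
  set a : α → α → ℝ := fun u v ↦
    φ (π v) / φ (π u) * if p v = u then t (π u) (π v) else 1 / t (π v) (π u) with ha
  have hchild : ∀ u v, p v = u → a u v = φ (π v) * t (π u) (π v) / φ (π u) := by
    intro u v huv
    rw [ha]
    simp only [if_pos huv]
    ring
  have hpar : ∀ u v, p v ≠ u → a u v = φ (π v) / t (π v) (π u) / φ (π u) := by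
    intro u v huv
    rw [ha]
    simp only [if_neg huv]
    ring
  have hinv : ∀ u v, T.Adj u v → p v = u → a u v * a v u = 1 := by
    intro u v huv hv
    rw [hchild u v hv, hpar v u (hanti u v huv hv)]
    have := (hφ (π u)).ne'
    have := (hφ (π v)).ne'
    have := (ht (π u) (π v)).ne'
    field_simp
  refine ⟨μ, hμ, quadForm_le_of_weight T (a := a) (fun u v ↦ ?_) (fun u v huv ↦ ?_) fun u ↦ ?_⟩
  · refine mul_pos (div_pos (hφ _) (hφ _)) ?_
    split_ifs
    · exact ht _ _
    · exact one_div_pos.2 (ht _ _)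
  · rcases hadj u v huv with h | h
    · rw [mul_comm]
      exact hinv v u huv.symm h
    · exact hinv u v huv h
  · have hsum := hπ.sum_neighborFinset (fun w ↦ φ w * t (π u) w) u
    by_cases hur : u = r
    · rw [Finset.sum_congr rfl fun v hv ↦ hchild u v ?_, ← Finset.sum_div, div_le_iff₀ (hφ _), hsum]
      · exact hroot _
      · have huv : T.Adj u v := by simpa using hv
        refine (hadj u v huv).resolve_left fun h ↦ huv.ne ?_
        rw [← h, hur, hpr]
    · obtain ⟨hpu, _⟩ := hp u hur
      have hmem : p u ∈ T.neighborFinset u := by simpa using hpu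
      rw [← Finset.sum_erase_add _ _ hmem, hpar u (p u) fun h ↦ hanti _ _ hpu h rfl,
        Finset.sum_congr rfl fun v hv ↦ hchild u v ?_, ← Finset.sum_div, ← add_div,
        div_le_iff₀ (hφ _)]
      · rw [← Finset.sum_erase_add _ _ hmem] at hsum
        have := hstep (π u) (π (p u))
        linarith
      · have huv : T.Adj u v := by simpa using Finset.mem_of_mem_erase hv
        exact (hadj u v huv).resolve_left fun h ↦ Finset.ne_of_mem_erase hv h.symm

/-- A bound on the quadratic form of unit vectors scales to all finitely supported vectors. -/
lemma quadForm_le_of_unit {α : Type*} {H : SimpleGraph α} {μ : ℝ}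
    (h : ∀ x : α →₀ ℝ, ∑ v ∈ x.support, x v ^ 2 = 1 → quadForm H x ≤ μ) (x : α →₀ ℝ) :
    quadForm H x ≤ μ * ∑ v ∈ x.support, x v ^ 2 := by
  classical
  rcases eq_or_ne x 0 with rfl | hx
  · simp [quadForm]
  set N := ∑ v ∈ x.support, x v ^ 2
  have hN : 0 < N := Finset.sum_pos
    (fun v hv ↦ by have := Finsupp.mem_support_iff.1 hv; positivity)
    (Finsupp.support_nonempty_iff.2 hx)
  set c := (√N)⁻¹ with hc
  have hc0 : c ≠ 0 := by positivity
  have hcN : c ^ 2 * N = 1 := by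
    rw [hc, inv_pow, Real.sq_sqrt hN.le, inv_mul_cancel₀ hN.ne']
  have hsupp : (c • x).support = x.support := Finsupp.support_smul_eq hc0
  have hq : quadForm H (c • x) = c ^ 2 * quadForm H x := by
    unfold quadForm
    rw [hsupp]
    simp only [Finset.mul_sum, Finsupp.smul_apply, smul_eq_mul]
    refine Finset.sum_congr rfl fun u _ ↦ Finset.sum_congr rfl fun v _ ↦ ?_
    split_ifs
    · ring
    · simp
  have := h (c • x) (by
    rw [hsupp]
    simpa only [Finsupp.smul_apply, smul_eq_mul, mul_pow, ← Finset.mul_sum] using hcN)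
  rw [hq] at this
  calc quadForm H x = c ^ 2 * quadForm H x * N := by linear_combination (-quadForm H x) * hcN
    _ ≤ μ * N := mul_le_mul_of_nonneg_right this hN.le

theorem sup_quadForm_cover_eq_lambdaOne_iff_at_most_one_cycle
    {α β : Type*} [Fintype β] [DecidableEq β] [Nonempty β]
    (G : SimpleGraph β) [DecidableRel G.Adj] (hG : G.Connected)
    (T : SimpleGraph α) (hT : T.IsTree)
    (π : T →g G) (hπ : IsGraphCover π) :
    sSup {r : ℝ | ∃ x : α →₀ ℝ, (∑ v ∈ x.support, (x v) ^ 2 = 1) ∧ quadForm T x = r}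
        = lambdaOne G
      ↔ (cycleSets G).Subsingleton := by
  classical
  let _ := hπ.locallyFinite
  obtain ⟨φ, hφ, heig⟩ := exists_pos_eigenvector_lambdaOne hG
  obtain ⟨r⟩ := hT.connected.nonempty
  have hne : {r : ℝ | ∃ x : α →₀ ℝ, (∑ v ∈ x.support, (x v) ^ 2 = 1) ∧
      quadForm T x = r}.Nonempty :=
    ⟨_, Finsupp.single r 1, by simp, rfl⟩
  have hle : ∀ x : α →₀ ℝ, quadForm T x ≤ lambdaOne G * ∑ v ∈ x.support, x v ^ 2 := by
    refine quadForm_le_of_weight T (a := fun u v ↦ φ (π v) / φ (π u))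
      (fun u v ↦ div_pos (hφ _) (hφ _)) (fun u v _ ↦ ?_) fun u ↦ ?_
    · have := (hφ (π u)).ne'
      have := (hφ (π v)).ne'
      field_simp
    · rw [← Finset.sum_div, hπ.sum_neighborFinset, heig, mul_div_cancel_right₀ _ (hφ _).ne']
  have hsSup : ∀ μ : ℝ, (∀ x : α →₀ ℝ, quadForm T x ≤ μ * ∑ v ∈ x.support, x v ^ 2) →
      ∀ q ∈ {r : ℝ | ∃ x : α →₀ ℝ, (∑ v ∈ x.support, (x v) ^ 2 = 1) ∧ quadForm T x = r},
        q ≤ μ := by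
    rintro μ hμ _ ⟨x, hx, rfl⟩
    simpa [hx] using hμ x
  refine ⟨fun heq ↦ ?_, fun hsub ↦ ?_⟩
  · by_contra hcyc
    obtain ⟨μ, hμ, hbound⟩ := exists_lt_quadForm_le hG
      (card_lt_card_edgeFinset_of_not_subsingleton hG hcyc) hT hπ hφ heig
    exact absurd (heq ▸ csSup_le hne (hsSup μ hbound)) hμ.not_ge
  · obtain ⟨s, hs, hadj⟩ := exists_selfMap_of_cycleSets_subsingleton hG hsub
    refine le_antisymm (csSup_le hne (hsSup _ hle)) ?_
    exact le_of_quadForm_le hT.connected hπ hs hadj hφ heig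
      (quadForm_le_of_unit fun x hx ↦ le_csSup ⟨_, hsSup _ hle⟩ ⟨x, hx, rfl⟩)
end

section
/- Let G be a finite connected simple graph containing at most one cycle (equivalently, |E(G)| ≤ |V(G)|), let T be a (possibly infinite) tree, and let π : T → G be a covering map. Then the supremum of f_T(x) = 2∑_{{u,v}∈E(T)} x_u x_v over all finitely supported x : V(T) → ℝ with ∑_v x_v² = 1 equals λ₁(G); in particular, for every ε > 0 there is such an x with f_T(x) > λ₁(G) − ε. -/
open SimpleGraph

namespace IsGraphCover

variable {α β : Type*} {T : SimpleGraph α} {G : SimpleGraph β} {π : T →g G}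

/-- A covering map sends walks without backtracking to walks without backtracking. -/
lemma isChain_edges_map (hπ : IsGraphCover π) {u v : α} (p : T.Walk u v)
    (hp : List.IsChain (· ≠ ·) p.edges) : List.IsChain (· ≠ ·) (p.map π).edges := by
  induction p with
  | nil => simp
  | @cons u v w h q ih =>
    cases q with
    | nil => simp
    | @cons _ w _ h' q =>
      simp only [Walk.edges_cons, Walk.map_cons, List.isChain_cons_cons] at hp ih ⊢
      refine ⟨fun he => hp.1 ?_, ih hp.2⟩
      have hne : π u = π w := by
        rw [Sym2.eq_swap] at he
        exact Sym2.congr_right.1 he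
      rw [(hπ v).injOn (show u ∈ T.neighborSet v from h.symm) (show w ∈ T.neighborSet v from h')
        hne, Sym2.eq_swap]

/-- A covering map onto a forest is injective on connected components. -/
lemma eq_of_reachable (hπ : IsGraphCover π) (hG : G.IsAcyclic) {u v : α}
    (h : T.Reachable u v) (he : π u = π v) : u = v := by
  classical
  obtain ⟨p, hp⟩ := h.exists_isPath
  have hpath : (p.map π).IsPath :=
    (hG.isPath_iff_isChain _).2 (hπ.isChain_edges_map p hp.isTrail.edges_nodup.isChain)
  have hpath' : ((p.map π).copy rfl he.symm).IsPath := (Walk.isPath_copy ..).2 hpath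
  have hlen := Walk.length_eq_zero_iff.2 (Walk.isPath_iff_nil.1 hpath')
  rw [Walk.length_copy, Walk.length_map] at hlen
  exact Walk.eq_of_length_eq_zero hlen

/-- A covering map onto a connected graph is surjective on every connected component. -/
lemma exists_reachable_map_eq (hπ : IsGraphCover π) (hG : G.Connected) (u : α) (b : β) :
    ∃ v, T.Reachable u v ∧ π v = b := by
  obtain ⟨p⟩ := hG.preconnected (π u) b
  generalize hx : π u = x at p
  induction p generalizing u with
  | nil => exact ⟨u, .rfl, hx⟩
  | @cons x y b h q ih =>
    subst hx
    obtain ⟨v, hv, hvy⟩ := (hπ u).surjOn h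
    obtain ⟨w, hw, hwb⟩ := ih v hvy
    exact ⟨w, (show T.Adj u v from hv).reachable.trans hw, hwb⟩

/-- A covering map onto a finite tree is bijective on every connected component. -/
lemma exists_component_bijOn [Fintype β] (hπ : IsGraphCover π) (hG : G.IsTree) (u : α) :
    ∃ C : Finset α, (∀ v, v ∈ C ↔ T.Reachable u v) ∧ Set.BijOn π C Set.univ := by
  classical
  choose σ hσ hπσ using hπ.exists_reachable_map_eq hG.connected u
  have hmem : ∀ v, v ∈ Finset.univ.image σ ↔ T.Reachable u v := by
    intro v
    simp only [Finset.mem_image, Finset.mem_univ, true_and]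
    constructor
    · rintro ⟨b, rfl⟩
      exact hσ b
    · intro hv
      exact ⟨π v, hπ.eq_of_reachable hG.isAcyclic ((hσ _).symm.trans hv) (hπσ _)⟩
  refine ⟨Finset.univ.image σ, hmem, fun _ _ => trivial, fun v hv w hw h => ?_,
    fun b _ => ⟨σ b, by simp, hπσ b⟩⟩
  exact hπ.eq_of_reachable hG.isAcyclic (((hmem v).1 hv).symm.trans ((hmem w).1 hw)) h

lemma sum_neighborFinset_s1 [Fintype β] [DecidableRel G.Adj] [T.LocallyFinite]
    (hπ : IsGraphCover π) (g : β → ℝ) (u : α) :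
    ∑ v ∈ T.neighborFinset u, g (π v) = ∑ b ∈ G.neighborFinset (π u), g b := by
  refine Finset.sum_nbij π ?_ ?_ ?_ fun _ _ => rfl
  · intro v hv
    simpa using (hπ u).mapsTo (by simpa using hv)
  · simpa using (hπ u).injOn
  · simpa using (hπ u).surjOn

end IsGraphCover

/-- A connected graph with at most one cycle is a tree plus at most one edge. -/
lemma exists_isTree_le_of_subsingleton_cycleSets {β : Type*} [Nonempty β] {G : SimpleGraph β}
    (hG : G.Connected) (hcyc : (cycleSets G).Subsingleton) :
    ∃ H ≤ G, H.IsTree ∧ ∃ a b, ∀ u v, G.Adj u v → ¬ H.Adj u v → s(u, v) = s(a, b) := by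
  by_cases hac : G.IsAcyclic
  · obtain ⟨a⟩ := ‹Nonempty β›
    exact ⟨G, le_rfl, ⟨hG, hac⟩, a, a, fun u v h h' => (h' h).elim⟩
  · simp only [IsAcyclic, not_forall, not_not] at hac
    obtain ⟨x, c, hc⟩ := hac
    obtain ⟨e, he⟩ : ∃ e, e ∈ c.edges := by
      refine List.exists_mem_of_ne_nil _ fun h => hc.ne_nil ?_
      exact Walk.edges_eq_nil.1 h |>.eq_nil
    induction e with | _ a b =>
    refine ⟨G.deleteEdges {s(a, b)}, deleteEdges_le _, ⟨?_, ?_⟩, a, b, fun u v h h' => ?_⟩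
    · exact hG.connected_delete_edge_of_not_isBridge
        fun hb => hb.notMem_edges_of_isCycle hc he
    · intro y d hd
      have hle : G.deleteEdges {s(a, b)} ≤ G := deleteEdges_le _
      have hmem : {e | e ∈ (d.mapLe hle).edges} = {e | e ∈ c.edges} :=
        hcyc ⟨y, _, hd.mapLe hle, rfl⟩ ⟨x, c, hc, rfl⟩
      have hab : s(a, b) ∈ d.edges := by
        have : s(a, b) ∈ {e | e ∈ (d.mapLe hle).edges} := hmem ▸ he
        simpa using this
      have := d.edges_subset_edgeSet hab
      simp at this
    · by_contra hne
      exact h' (deleteEdges_adj.2 ⟨h, hne⟩)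

section Rayleigh

variable {β : Type*} [Fintype β] [DecidableEq β] [Nonempty β] (G : SimpleGraph β)
  [DecidableRel G.Adj]

/-- There is a unit eigenvector for the largest eigenvalue. -/
lemma exists_unit_eigenvector_lambdaOne :
    ∃ g : β → ℝ, ∑ b, g b ^ 2 = 1 ∧
      ∀ a, ∑ b ∈ G.neighborFinset a, g b = lambdaOne G * g a := by
  have hA := adjMatrix_isHermitian G
  obtain ⟨i, hi⟩ := exists_eq_ciSup_of_finite (f := hA.eigenvalues)
  refine ⟨⇑(hA.eigenvectorBasis i), ?_, fun a => ?_⟩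
  · have := hA.eigenvectorBasis.orthonormal.norm_eq_one i
    rw [EuclideanSpace.norm_eq, Real.sqrt_eq_one] at this
    simpa using this
  · have := congrFun (hA.mulVec_eigenvectorBasis i) a
    rw [adjMatrix_mulVec_apply] at this
    rw [this, lambdaOne, ← hi]
    rfl

/-- The Rayleigh quotient is at most the largest eigenvalue. -/
lemma sum_adj_mul_le_lambdaOne_mul (y : β → ℝ) :
    ∑ a, ∑ b, (if G.Adj a b then y a * y b else 0) ≤ lambdaOne G * ∑ a, y a ^ 2 := by
  have hA := adjMatrix_isHermitian G
  set Y : EuclideanSpace ℝ β := WithLp.toLp 2 y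
  set Z : EuclideanSpace ℝ β := WithLp.toLp 2 ((G.adjMatrix ℝ).mulVec y)
  set e := hA.eigenvectorBasis
  have hYZ : inner ℝ Y Z = ∑ a, ∑ b, (if G.Adj a b then y a * y b else 0) := by
    simp only [Y, Z, PiLp.inner_apply, Matrix.mulVec, dotProduct, adjMatrix_apply,
      RCLike.inner_apply, conj_trivial]
    refine Finset.sum_congr rfl fun a _ => ?_
    rw [Finset.sum_mul]
    refine Finset.sum_congr rfl fun b _ => ?_
    split_ifs <;> ring
  have hYY : inner ℝ Y Y = ∑ a, y a ^ 2 := by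
    simp only [Y, PiLp.inner_apply, RCLike.inner_apply, conj_trivial, sq]
  have heZ : ∀ i, inner ℝ (e i) Z = hA.eigenvalues i * inner ℝ (e i) Y := by
    intro i
    have h := hA.mulVec_eigenvectorBasis i
    have hs : ∀ a b : β → ℝ, a ⬝ᵥ (G.adjMatrix ℝ).mulVec b = ((G.adjMatrix ℝ).mulVec a) ⬝ᵥ b := by
      intro a b
      rw [Matrix.dotProduct_mulVec, ← Matrix.mulVec_transpose, G.transpose_adjMatrix]
    have h1 : inner ℝ (e i) Z = ⇑(e i) ⬝ᵥ (G.adjMatrix ℝ).mulVec y := by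
      simp [PiLp.inner_apply, dotProduct, Z, mul_comm]
    have h2 : inner ℝ (e i) Y = ⇑(e i) ⬝ᵥ y := by
      simp [PiLp.inner_apply, dotProduct, Y, mul_comm]
    rw [h1, h2, hs, h, smul_dotProduct, smul_eq_mul]
  rw [← hYZ, ← hYY, ← e.sum_inner_mul_inner Y Z, ← e.sum_inner_mul_inner Y Y, Finset.mul_sum]
  refine Finset.sum_le_sum fun i _ => ?_
  rw [heZ, real_inner_comm Y (e i)]
  have hle : hA.eigenvalues i ≤ lambdaOne G := le_ciSup (Set.finite_range _).bddAbove i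
  nlinarith [mul_le_mul_of_nonneg_right hle (mul_self_nonneg (inner ℝ Y (e i)))]

end Rayleigh

open scoped Classical in
lemma quadForm_eq_sum_of_support_subset {α : Type*} (H : SimpleGraph α) (x : α →₀ ℝ)
    {F : Finset α} (hF : x.support ⊆ F) :
    quadForm H x = ∑ u ∈ F, ∑ v ∈ F, if H.Adj u v then x u * x v else 0 := by
  unfold quadForm
  rw [Finset.sum_subset hF]
  · refine Finset.sum_congr rfl fun u _ => Finset.sum_subset hF fun v _ hv => ?_
    simp [Finsupp.notMem_support_iff.1 hv]
  · intro u _ hu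
    simp [Finsupp.notMem_support_iff.1 hu]

/-- The quadratic form of a cover of `G` is bounded by the largest eigenvalue of `G`. -/
lemma IsGraphCover.quadForm_le {α β : Type*} [Fintype β] [DecidableEq β] [Nonempty β]
    {G : SimpleGraph β} [DecidableRel G.Adj] {T : SimpleGraph α} {π : T →g G}
    (hπ : IsGraphCover π) (x : α →₀ ℝ) :
    quadForm T x ≤ lambdaOne G * ∑ v ∈ x.support, x v ^ 2 := by
  classical
  set S := x.support
  set m : β → ℝ := fun a => ∑ v ∈ S with π v = a, x v ^ 2
  have hm : ∀ a, 0 ≤ m a := fun a => Finset.sum_nonneg fun _ _ => sq_nonneg _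
  have hsum : ∑ v ∈ S, x v ^ 2 = ∑ a, √(m a) ^ 2 := by
    simp only [Real.sq_sqrt (hm _), m]
    exact (Finset.sum_fiberwise S π _).symm
  rw [hsum]
  refine le_trans ?_ (sum_adj_mul_le_lambdaOne_mul G fun a => √(m a))
  have hquad : quadForm T x = ∑ a, ∑ b, ∑ u ∈ S with π u = a, ∑ v ∈ S with π v = b,
      if T.Adj u v then x u * x v else 0 := by
    unfold quadForm
    refine (Finset.sum_fiberwise S π _).symm.trans (Finset.sum_congr rfl fun a _ => ?_)
    refine Eq.trans (Finset.sum_congr rfl fun u _ => ?_) Finset.sum_comm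
    exact (Finset.sum_fiberwise S π _).symm
  rw [hquad]
  refine Finset.sum_le_sum fun a _ => Finset.sum_le_sum fun b _ => ?_
  split_ifs with hab
  · rw [← Finset.sum_product' (f := fun u v => if T.Adj u v then x u * x v else 0),
      ← Finset.sum_filter]
    set P := ((S.filter (π · = a)) ×ˢ (S.filter (π · = b))).filter fun d => T.Adj d.1 d.2
    have hP : ∀ d, d ∈ P ↔ (d.1 ∈ S ∧ π d.1 = a) ∧ (d.2 ∈ S ∧ π d.2 = b) ∧ T.Adj d.1 d.2 := by
      intro d
      simp [P, and_assoc]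
    refine (Real.sum_mul_le_sqrt_mul_sqrt P _ _).trans ?_
    refine mul_le_mul (Real.sqrt_le_sqrt ?_) (Real.sqrt_le_sqrt ?_) (Real.sqrt_nonneg _)
      (Real.sqrt_nonneg _)
    · rw [← Finset.sum_image (f := fun u => x u ^ 2) (g := Prod.fst)]
      · refine Finset.sum_le_sum_of_subset_of_nonneg ?_ fun _ _ _ => sq_nonneg _
        intro u hu
        obtain ⟨d, hd, rfl⟩ := Finset.mem_image.1 hu
        simpa using ((hP d).1 hd).1
      · rintro ⟨u, v⟩ hd ⟨u', v'⟩ hd' (rfl : u = u')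
        obtain ⟨_, ⟨_, hv⟩, h⟩ := (hP _).1 hd
        obtain ⟨_, ⟨_, hv'⟩, h'⟩ := (hP _).1 hd'
        rw [(hπ u).injOn (show v ∈ T.neighborSet u from h) (show v' ∈ T.neighborSet u from h')
          (hv.trans hv'.symm)]
    · rw [← Finset.sum_image (f := fun u => x u ^ 2) (g := Prod.snd)]
      · refine Finset.sum_le_sum_of_subset_of_nonneg ?_ fun _ _ _ => sq_nonneg _
        intro u hu
        obtain ⟨d, hd, rfl⟩ := Finset.mem_image.1 hu
        simpa using ((hP d).1 hd).2.1
      · rintro ⟨u, v⟩ hd ⟨u', v'⟩ hd' (rfl : v = v')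
        obtain ⟨⟨_, hv⟩, _, h⟩ := (hP _).1 hd
        obtain ⟨⟨_, hv'⟩, _, h'⟩ := (hP _).1 hd'
        rw [(hπ v).injOn (show u ∈ T.neighborSet v from h.symm)
          (show u' ∈ T.neighborSet v from h'.symm) (hv.trans hv'.symm)]
  · refine (Finset.sum_eq_zero fun u hu => Finset.sum_eq_zero fun v hv => ?_).le
    rw [Finset.mem_filter] at hu hv
    refine if_neg fun h => hab ?_
    rw [← hu.2, ← hv.2]
    exact π.map_adj h

section Boundary

variable {α : Type*} (T : SimpleGraph α) [T.LocallyFinite]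

open scoped Classical in
/-- The darts of `T` that leave the finite vertex set `F`. -/
noncomputable def outgoingDarts (F : Finset α) : Finset (Σ _ : α, α) :=
  F.sigma fun u => {v ∈ T.neighborFinset u | v ∉ F}

variable {T}

lemma mem_outgoingDarts {F : Finset α} {d : Σ _ : α, α} :
    d ∈ outgoingDarts T F ↔ d.1 ∈ F ∧ T.Adj d.1 d.2 ∧ d.2 ∉ F := by
  simp [outgoingDarts]

/-- Cutting off an eigenfunction to a finite set loses only a boundary term. -/
lemma le_quadForm_of_eigenfunction {l c : ℝ} {f : α → ℝ} {F : Finset α}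
    (hf : ∀ u, ∑ v ∈ T.neighborFinset u, f v = l * f u) (hc : ∀ u v, f u * f v ≤ c)
    (x : α →₀ ℝ) (hx : x.support ⊆ F) (hxf : ∀ v ∈ F, x v = f v) :
    l * ∑ v ∈ F, f v ^ 2 - (outgoingDarts T F).card * c ≤ quadForm T x := by
  classical
  have hout : ∑ d ∈ outgoingDarts T F, f d.1 * f d.2 ≤ (outgoingDarts T F).card * c := by
    simpa using Finset.sum_le_card_nsmul (outgoingDarts T F) (fun d => f d.1 * f d.2) c
      fun d _ => hc d.1 d.2
  have hsplit : quadForm T x + ∑ d ∈ outgoingDarts T F, f d.1 * f d.2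
      = l * ∑ v ∈ F, f v ^ 2 := by
    rw [quadForm_eq_sum_of_support_subset T x hx, outgoingDarts, Finset.sum_sigma,
      ← Finset.sum_add_distrib, Finset.mul_sum]
    refine Finset.sum_congr rfl fun u hu => ?_
    have hin : ∑ v ∈ F, (if T.Adj u v then x u * x v else 0)
        = ∑ v ∈ T.neighborFinset u with v ∈ F, f u * f v := by
      rw [← Finset.sum_filter]
      refine Finset.sum_congr ?_ fun v hv => ?_
      · ext v
        simp [and_comm]
      · rw [Finset.mem_filter] at hv
        rw [hxf u hu, hxf v hv.2]
    rw [hin, Finset.sum_filter_add_sum_filter_not, ← Finset.mul_sum, hf]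
    ring
  linarith

end Boundary

section Exhaustion

variable {α β : Type*} {T : SimpleGraph α} {G H : SimpleGraph β} {π : T →g G}

/-- Restricting a cover of `G` to the edges over a subgraph `H` gives a cover of `H`. -/
lemma IsGraphCover.restrict (hπ : IsGraphCover π) (hH : H ≤ G) :
    IsGraphCover (T := T ⊓ H.comap π) (G := H) ⟨π, fun h => h.2⟩ := by
  refine fun u => ⟨fun v hv => hv.2, fun v hv w hw h => (hπ u).injOn hv.1 hw.1 h, fun b hb => ?_⟩
  obtain ⟨v, hv, rfl⟩ := (hπ u).surjOn (hH hb)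
  exact ⟨v, ⟨hv, hb⟩, rfl⟩

variable [Fintype β] [T.LocallyFinite]

/-- A component of the part of the cover over a spanning tree `H` with at most one further edge
is a sheet with at most two outgoing darts. -/
lemma IsGraphCover.exists_sheet (hπ : IsGraphCover π) (hH : H ≤ G) (hHt : H.IsTree) {a b : β}
    (hab : ∀ u v, G.Adj u v → ¬ H.Adj u v → s(u, v) = s(a, b)) (u : α) :
    ∃ C : Finset α, (∀ v, v ∈ C ↔ (T ⊓ H.comap π).Reachable u v) ∧ Set.BijOn π C Set.univ ∧
      (outgoingDarts T C).card ≤ 2 := by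
  classical
  obtain ⟨C, hC, hbij⟩ := (hπ.restrict hH).exists_component_bijOn hHt u
  refine ⟨C, hC, hbij, ?_⟩
  have hedge : ∀ d ∈ outgoingDarts T C, s(π d.1, π d.2) = s(a, b) := by
    intro d hd
    obtain ⟨h1, hadj, h2⟩ := mem_outgoingDarts.1 hd
    refine hab _ _ (π.map_adj hadj) fun h => h2 ((hC _).2 (((hC _).1 h1).trans ?_))
    exact Adj.reachable (show (T ⊓ H.comap π).Adj d.1 d.2 from ⟨hadj, h⟩)
  refine (Finset.card_le_card_of_injOn (t := {a, b}) (fun d => π d.1) ?_ ?_).trans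
    Finset.card_le_two
  · intro d hd
    have : π d.1 ∈ s(a, b) := hedge d hd ▸ Sym2.mem_mk_left _ _
    simpa using this
  · rintro ⟨v, w⟩ hd ⟨v', w'⟩ hd' (h : π v = π v')
    obtain ⟨h1, hadj, -⟩ := mem_outgoingDarts.1 hd
    obtain ⟨h1', hadj', -⟩ := mem_outgoingDarts.1 hd'
    obtain rfl : v = v' := hbij.injOn h1 h1' h
    have hw : π w = π w' := Sym2.congr_right.1 ((hedge _ hd).trans (hedge _ hd').symm)
    rw [(hπ v).injOn (show w ∈ T.neighborSet v from hadj) (show w' ∈ T.neighborSet v from hadj')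
      hw]

/-- Finite unions of sheets with at most two outgoing darts which are arbitrarily large, unless
they exhaust the cover. -/
lemma IsGraphCover.exists_union_sheets [Nonempty α] (hπ : IsGraphCover π) (hH : H ≤ G)
    (hHt : H.IsTree) {a b : β} (hab : ∀ u v, G.Adj u v → ¬ H.Adj u v → s(u, v) = s(a, b))
    (k : ℕ) :
    ∃ (F : Finset α) (n : ℕ), 1 ≤ n ∧ (∀ g : β → ℝ, ∑ v ∈ F, g (π v) = n * ∑ b, g b) ∧
      (∀ v ∈ F, ∀ w, (T ⊓ H.comap π).Reachable v w → w ∈ F) ∧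
      (outgoingDarts T F).card ≤ 2 ∧ (k ≤ n ∨ outgoingDarts T F = ∅) := by
  classical
  have hsum : ∀ C : Finset α, Set.BijOn π C Set.univ →
      ∀ g : β → ℝ, ∑ v ∈ C, g (π v) = ∑ b, g b := fun C hC g =>
    Finset.sum_nbij π (fun _ _ => Finset.mem_univ _) hC.injOn (by simpa using hC.surjOn)
      fun _ _ => rfl
  induction k with
  | zero =>
    obtain ⟨C, hC, hbij, hcard⟩ := hπ.exists_sheet hH hHt hab (Classical.arbitrary α)
    exact ⟨C, 1, le_rfl, fun g => by simp [hsum C hbij g],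
      fun v hv w hw => (hC w).2 (((hC v).1 hv).trans hw), hcard, .inl (Nat.zero_le _)⟩
  | succ k ih =>
    obtain ⟨F, n, hn, hF, hcl, hcard, hk⟩ := ih
    by_cases hemp : outgoingDarts T F = ∅
    · exact ⟨F, n, hn, hF, hcl, hcard, .inr hemp⟩
    obtain ⟨⟨u, v⟩, hd⟩ := Finset.nonempty_iff_ne_empty.2 hemp
    obtain ⟨hu, huv, hv⟩ := mem_outgoingDarts.1 hd
    obtain ⟨C, hC, hbij, hcardC⟩ := hπ.exists_sheet hH hHt hab v
    have hdisj : Disjoint F C := Finset.disjoint_left.2 fun w hwF hwC =>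
      hv (hcl w hwF v ((hC w).1 hwC).symm)
    have hvC : v ∈ C := (hC v).2 .rfl
    have hd' : ⟨v, u⟩ ∈ outgoingDarts T C :=
      mem_outgoingDarts.2 ⟨hvC, huv.symm, Finset.disjoint_left.1 hdisj hu⟩
    have hsub : outgoingDarts T (F ∪ C) ⊆
        (outgoingDarts T F).erase ⟨u, v⟩ ∪ (outgoingDarts T C).erase ⟨v, u⟩ := by
      rintro ⟨p, q⟩ hpq
      simp only [mem_outgoingDarts, Finset.mem_union, not_or] at hpq
      obtain ⟨hp, hadj, hqF, hqC⟩ := hpq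
      rw [Finset.mem_union, Finset.mem_erase, Finset.mem_erase]
      rcases hp with hp | hp
      · refine .inl ⟨?_, mem_outgoingDarts.2 ⟨hp, hadj, hqF⟩⟩
        rintro ⟨⟩
        exact hqC hvC
      · refine .inr ⟨?_, mem_outgoingDarts.2 ⟨hp, hadj, hqC⟩⟩
        rintro ⟨⟩
        exact hqF hu
    refine ⟨F ∪ C, n + 1, by omega, fun g => ?_, fun x hx w hw => ?_, ?_, .inl ?_⟩
    · rw [Finset.sum_union hdisj, hF, hsum C hbij]
      push_cast
      ring
    · rw [Finset.mem_union] at hx ⊢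
      exact hx.imp (fun h => hcl x h w hw) fun h => (hC w).2 (((hC x).1 h).trans hw)
    · have h := (Finset.card_le_card hsub).trans (Finset.card_union_le _ _)
      rw [Finset.card_erase_of_mem hd, Finset.card_erase_of_mem hd'] at h
      omega
    · have := hk.resolve_right hemp
      omega

end Exhaustion

/-- Over a connected graph with at most one cycle, the largest eigenvalue is approached by finitely
supported unit vectors on any nonempty cover. -/
lemma IsGraphCover.exists_lambdaOne_sub_lt_quadForm {α β : Type*} [Nonempty α] [Fintype β]
    [DecidableEq β] [Nonempty β] {G : SimpleGraph β} [DecidableRel G.Adj] (hG : G.Connected)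
    (hcyc : (cycleSets G).Subsingleton) {T : SimpleGraph α} {π : T →g G} (hπ : IsGraphCover π)
    {ε : ℝ} (hε : 0 < ε) :
    ∃ x : α →₀ ℝ, ∑ v ∈ x.support, x v ^ 2 = 1 ∧ lambdaOne G - ε < quadForm T x := by
  classical
  have : T.LocallyFinite := fun v =>
    ((hπ v).finite_iff_finite.2 (Set.toFinite _)).fintype
  obtain ⟨H, hH, hHt, a, b, hab⟩ := exists_isTree_le_of_subsingleton_cycleSets hG hcyc
  obtain ⟨g, hg1, hg⟩ := exists_unit_eigenvector_lambdaOne G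
  obtain ⟨k, hk⟩ := exists_nat_gt (2 / ε)
  obtain ⟨F, n, hn, hF, -, hcard, hkn⟩ := hπ.exists_union_sheets hH hHt hab k
  have hn0 : (0 : ℝ) < n := by exact_mod_cast hn
  have hsq : √(n : ℝ) ^ 2 = n := Real.sq_sqrt hn0.le
  have hle : ∀ b, g b ^ 2 ≤ 1 := fun b =>
    hg1 ▸ Finset.single_le_sum (f := fun b => g b ^ 2) (fun _ _ => sq_nonneg _) (Finset.mem_univ b)
  set f : α → ℝ := fun v => g (π v) / √n
  set x : α →₀ ℝ := Finsupp.onFinset F (fun v => if v ∈ F then f v else 0) fun v hv => by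
    by_contra h
    simp [h] at hv
  have hx : x.support ⊆ F := Finsupp.support_onFinset_subset
  have hxf : ∀ v ∈ F, x v = f v := fun v hv => by simp [x, hv]
  have hmass : ∑ v ∈ F, f v ^ 2 = 1 := by
    simp only [f, div_pow, hsq, ← Finset.sum_div]
    rw [hF fun b => g b ^ 2, hg1, mul_one, div_self hn0.ne']
  have hf : ∀ u, ∑ v ∈ T.neighborFinset u, f v = lambdaOne G * f u := fun u => by
    simp only [f, ← Finset.sum_div]
    rw [hπ.sum_neighborFinset_s1, hg, mul_div_assoc]
  have hc : ∀ u v, f u * f v ≤ 1 / n := fun u v => by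
    simp only [f]
    rw [div_mul_div_comm, ← sq, hsq]
    gcongr
    nlinarith [hle (π u), hle (π v), sq_nonneg (g (π u) - g (π v))]
  refine ⟨x, ?_, ?_⟩
  · rw [← hmass, Finset.sum_subset hx fun v _ hv => by simp [Finsupp.notMem_support_iff.1 hv]]
    exact Finset.sum_congr rfl fun v hv => by rw [hxf v hv]
  · refine lt_of_lt_of_le ?_ (le_quadForm_of_eigenfunction hf hc x hx hxf)
    have hloss : (outgoingDarts T F).card * (1 / (n : ℝ)) < ε := by
      rcases hkn with hkn | hemp
      · have hkn' : (k : ℝ) ≤ n := by exact_mod_cast hkn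
        have hcard' : ((outgoingDarts T F).card : ℝ) ≤ 2 := by exact_mod_cast hcard
        rw [mul_one_div, div_lt_iff₀ hn0]
        rw [div_lt_iff₀ hε] at hk
        nlinarith
      · simpa [hemp] using hε
    rw [hmass]
    linarith

theorem sup_quadForm_cover_eq_lambdaOne_of_at_most_one_cycle
    {α β : Type*} [Fintype β] [DecidableEq β] [Nonempty β]
    (G : SimpleGraph β) [DecidableRel G.Adj] (hG : G.Connected)
    (hcyc : (cycleSets G).Subsingleton)
    (T : SimpleGraph α) (hT : T.IsTree)
    (π : T →g G) (hπ : IsGraphCover π) :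
    sSup {r : ℝ | ∃ x : α →₀ ℝ, (∑ v ∈ x.support, (x v) ^ 2 = 1) ∧ quadForm T x = r}
        = lambdaOne G ∧
      ∀ ε : ℝ, 0 < ε → ∃ x : α →₀ ℝ,
        (∑ v ∈ x.support, (x v) ^ 2 = 1) ∧ lambdaOne G - ε < quadForm T x := by
  have := hT.connected.nonempty
  have hlower := fun ε (hε : (0 : ℝ) < ε) => hπ.exists_lambdaOne_sub_lt_quadForm hG hcyc hε
  have hupper : ∀ r ∈ {r : ℝ | ∃ x : α →₀ ℝ, (∑ v ∈ x.support, (x v) ^ 2 = 1) ∧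
      quadForm T x = r}, r ≤ lambdaOne G := by
    rintro r ⟨x, hx, rfl⟩
    simpa [hx] using hπ.quadForm_le x
  refine ⟨csSup_eq_of_forall_le_of_forall_lt_exists_gt ?_ hupper fun w hw => ?_, hlower⟩
  · obtain ⟨x, hx, -⟩ := hlower 1 one_pos
    exact ⟨_, x, hx, rfl⟩
  · obtain ⟨x, hx, hlt⟩ := hlower _ (sub_pos.2 hw)
    exact ⟨_, ⟨x, hx, rfl⟩, by linarith⟩
end

section
/- Let G be a finite simple graph, let T be a simple graph, and let π : T → G be a covering map. Then for every finitely supported x : V(T) → ℝ with ∑_v x_v² = 1, one has f_T(x) = 2∑_{{u,v}∈E(T)} x_u x_v ≤ λ₁(G). In particular the spectral radius of a cover of G is at most λ₁(G). -/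
open SimpleGraph

/-- The Rayleigh quotient of a real symmetric matrix is at most its largest eigenvalue. -/
lemma Matrix.IsHermitian.dotProduct_mulVec_le_iSup_eigenvalues {n : Type*} [Fintype n]
    [DecidableEq n] {A : Matrix n n ℝ} (hA : A.IsHermitian) (y : n → ℝ) :
    y ⬝ᵥ A.mulVec y ≤ (⨆ i, hA.eigenvalues i) * ∑ i, y i ^ 2 := by
  set c := ⨆ i, hA.eigenvalues i with hc
  have hpos : (algebraMap ℝ (Matrix n n ℝ) c - A).PosSemidef := by
    rw [Matrix.posSemidef_iff_isHermitian_and_spectrum_nonneg]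
    refine ⟨(Matrix.isHermitian_diagonal _).sub hA, ?_⟩
    rw [← spectrum.singleton_sub_eq, hA.spectrum_real_eq_range_eigenvalues]
    rintro _ ⟨_, rfl, _, ⟨i, rfl⟩, rfl⟩
    exact sub_nonneg.2 (le_ciSup (Set.finite_range hA.eigenvalues).bddAbove i)
  have h := hpos.dotProduct_mulVec_nonneg y
  rw [Matrix.sub_mulVec, dotProduct_sub, Algebra.algebraMap_eq_smul_one, Matrix.smul_mulVec,
    Matrix.one_mulVec, dotProduct_smul, star_trivial] at h
  simpa [dotProduct, pow_two] using h

/-- Over a pair of vertices of the base, a locally injective homomorphism has edges forming a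
matching between the two fibres, so Cauchy-Schwarz bounds their contribution. -/
lemma sum_fiber_mul_le {α β : Type*} [DecidableEq β] {T : SimpleGraph α} [DecidableRel T.Adj]
    {G : SimpleGraph β} [DecidableRel G.Adj] (π : T →g G)
    (hπ : ∀ v, Set.InjOn π (T.neighborSet v)) (s : Finset α) (x : α → ℝ) (a b : β) :
    (∑ u ∈ s with π u = a, ∑ v ∈ s with π v = b, if T.Adj u v then x u * x v else 0) ≤
      if G.Adj a b then √(∑ u ∈ s with π u = a, x u ^ 2) * √(∑ v ∈ s with π v = b, x v ^ 2)
      else 0 := by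
  classical
  split_ifs with hab
  · set P := ((s.filter (π · = a)) ×ˢ (s.filter (π · = b))).filter (fun p ↦ T.Adj p.1 p.2) with hP
    have hmem : ∀ p ∈ P, p.1 ∈ s.filter (π · = a) ∧ p.2 ∈ s.filter (π · = b) ∧
        T.Adj p.1 p.2 := fun p hp ↦ by
      simpa only [hP, Finset.mem_filter, Finset.mem_product, and_assoc] using hp
    have hfst : Set.InjOn Prod.fst (P : Set (α × α)) := by
      rintro ⟨u, v⟩ hp ⟨u', v'⟩ hq (rfl : u = u')
      obtain ⟨-, hv, hadj⟩ := hmem _ hp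
      obtain ⟨-, hv', hadj'⟩ := hmem _ hq
      exact Prod.ext rfl <| hπ u hadj hadj' <|
        (Finset.mem_filter.1 hv).2.trans (Finset.mem_filter.1 hv').2.symm
    have hsnd : Set.InjOn Prod.snd (P : Set (α × α)) := by
      rintro ⟨u, v⟩ hp ⟨u', v'⟩ hq (rfl : v = v')
      obtain ⟨hu, -, hadj⟩ := hmem _ hp
      obtain ⟨hu', -, hadj'⟩ := hmem _ hq
      refine Prod.ext ?_ rfl
      exact hπ v hadj.symm hadj'.symm <|
        (Finset.mem_filter.1 hu).2.trans (Finset.mem_filter.1 hu').2.symm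
    rw [← Finset.sum_product', ← Finset.sum_filter]
    refine (Real.sum_mul_le_sqrt_mul_sqrt P (fun p ↦ x p.1) (fun p ↦ x p.2)).trans ?_
    gcongr
    · rw [← Finset.sum_image (f := fun u ↦ x u ^ 2) hfst]
      exact Finset.sum_le_sum_of_subset_of_nonneg
        (Finset.image_subset_iff.2 fun p hp ↦ (hmem p hp).1) fun _ _ _ ↦ sq_nonneg _
    · rw [← Finset.sum_image (f := fun u ↦ x u ^ 2) hsnd]
      exact Finset.sum_le_sum_of_subset_of_nonneg
        (Finset.image_subset_iff.2 fun p hp ↦ (hmem p hp).2.1) fun _ _ _ ↦ sq_nonneg _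
  · refine (Finset.sum_eq_zero fun u hu ↦ Finset.sum_eq_zero fun v hv ↦ if_neg fun h ↦ hab ?_).le
    rw [← (Finset.mem_filter.1 hu).2, ← (Finset.mem_filter.1 hv).2]
    exact π.map_adj h

theorem quadForm_cover_le_lambdaOne
    {α β : Type*} [Fintype β] [DecidableEq β] [Nonempty β]
    (G : SimpleGraph β) [DecidableRel G.Adj]
    (T : SimpleGraph α) (π : T →g G) (hπ : IsGraphCover π) :
    ∀ x : α →₀ ℝ, (∑ v ∈ x.support, (x v) ^ 2 = 1) → quadForm T x ≤ lambdaOne G := by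
  classical
  intro x hx
  set y : β → ℝ := fun a ↦ √(∑ u ∈ x.support with π u = a, x u ^ 2)
  have hnorm : ∑ a, y a ^ 2 = 1 := by
    rw [← hx, ← Finset.sum_fiberwise x.support π]
    exact Finset.sum_congr rfl fun a _ ↦ Real.sq_sqrt (Finset.sum_nonneg fun _ _ ↦ sq_nonneg _)
  calc quadForm T x
      = ∑ a, ∑ b, ∑ u ∈ x.support with π u = a, ∑ v ∈ x.support with π v = b,
          if T.Adj u v then x u * x v else 0 := by
        rw [quadForm, ← Finset.sum_fiberwise x.support π]
        refine Finset.sum_congr rfl fun a _ ↦ ?_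
        refine Eq.trans (Finset.sum_congr rfl fun u _ ↦ ?_) Finset.sum_comm
        rw [Finset.sum_fiberwise x.support π]
    _ ≤ ∑ a, ∑ b, if G.Adj a b then y a * y b else 0 := by
        refine Finset.sum_le_sum fun a _ ↦ Finset.sum_le_sum fun b _ ↦ ?_
        exact sum_fiber_mul_le π (fun v ↦ (hπ v).injOn) x.support x a b
    _ = y ⬝ᵥ (G.adjMatrix ℝ).mulVec y := by
        simp [dotProduct, Matrix.mulVec, Finset.mul_sum, adjMatrix_apply]
    _ ≤ lambdaOne G * ∑ a, y a ^ 2 :=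
        (adjMatrix_isHermitian G).dotProduct_mulVec_le_iSup_eigenvalues y
    _ = lambdaOne G := by rw [hnorm, mul_one]
end

section
/- Let H be a connected locally finite simple graph whose every vertex has degree at most Δ, and let x and y be vertices of H at graph distance d from each other. Then for every k ≥ 0, |W|_{2k}(H,y) ≤ Δ^{2d} · |W|_{2k}(H,x). -/
open SimpleGraph

/-- `|W|_k(H,v)`: the number of closed walks of length `k` at `v` in the locally finite
graph `H`. -/
def numClosedWalks {α : Type*} [DecidableEq α] (H : SimpleGraph α) [LocallyFinite H]
    (v : α) (k : ℕ) : ℕ :=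
  (H.finsetWalkLength k v v).card

namespace SimpleGraph

open scoped ENNReal

variable {α : Type*}

theorem Walk.append_right_injective {G : SimpleGraph α} {u v w : α} (p : G.Walk u v) :
    Function.Injective fun q : G.Walk v w ↦ p.append q := by
  induction p with
  | nil => exact fun _ _ h ↦ h
  | cons h p ih =>
    intro q q' hq
    simp only [Walk.cons_append, Walk.cons.injEq, heq_eq_eq, true_and] at hq
    exact ih hq

theorem Walk.append_left_injective {G : SimpleGraph α} {u v w : α} (p : G.Walk v w) :
    Function.Injective fun q : G.Walk u v ↦ q.append p := by
  intro q q' h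
  apply Walk.reverse_injective
  apply Walk.append_right_injective p.reverse
  simpa only [Walk.reverse_append] using congrArg Walk.reverse h

variable (H : SimpleGraph α) [LocallyFinite H]

theorem sum_neighborFinset_eq_tsum (g : α → ℝ≥0∞) (u : α) :
    ∑ w ∈ H.neighborFinset u, g w = ∑' w, (H.neighborSet u).indicator 1 w * g w := by
  rw [tsum_eq_sum (s := H.neighborFinset u)]
  · exact Finset.sum_congr rfl fun w hw ↦ by
      rw [mem_neighborFinset] at hw
      simp [hw]
  · intro w hw
    rw [mem_neighborFinset] at hw
    simp [hw]

theorem tsum_indicator_neighborSet (w : α) :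
    ∑' u, (H.neighborSet u).indicator (1 : α → ℝ≥0∞) w = H.degree w := by
  have h := H.sum_neighborFinset_eq_tsum 1 w
  simp only [Pi.one_apply, Finset.sum_const, card_neighborFinset_eq_degree, nsmul_eq_mul,
    mul_one] at h
  rw [h]
  exact tsum_congr fun u ↦ by classical simp [Set.indicator_apply, H.adj_comm]

theorem tsum_sq_sum_neighborFinset_le {Δ : ℕ} (hdeg : ∀ v, H.degree v ≤ Δ) (f : α → ℕ) :
    ∑' u, ((∑ w ∈ H.neighborFinset u, f w : ℕ) : ℝ≥0∞) ^ 2 ≤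
      (Δ : ℝ≥0∞) ^ 2 * ∑' w, (f w : ℝ≥0∞) ^ 2 := by
  have cauchySchwarz (u : α) : ((∑ w ∈ H.neighborFinset u, f w : ℕ) : ℝ≥0∞) ^ 2 ≤
      Δ * ∑' w, (H.neighborSet u).indicator 1 w * (f w : ℝ≥0∞) ^ 2 := by
    rw [← sum_neighborFinset_eq_tsum]
    have h : (∑ w ∈ H.neighborFinset u, f w) ^ 2 ≤ Δ * ∑ w ∈ H.neighborFinset u, f w ^ 2 :=
      sq_sum_le_card_mul_sum_sq.trans <| Nat.mul_le_mul_right _ <| by simpa using hdeg u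
    exact_mod_cast h
  calc
    _ ≤ ∑' u, (Δ : ℝ≥0∞) * ∑' w, (H.neighborSet u).indicator 1 w * (f w : ℝ≥0∞) ^ 2 :=
      ENNReal.tsum_le_tsum cauchySchwarz
    _ = Δ * ∑' w, H.degree w * (f w : ℝ≥0∞) ^ 2 := by
      rw [ENNReal.tsum_mul_left, ENNReal.tsum_comm]
      simp_rw [ENNReal.tsum_mul_right, tsum_indicator_neighborSet]
    _ ≤ Δ * ∑' w, Δ * (f w : ℝ≥0∞) ^ 2 := by
      gcongr with w
      exact hdeg w
    _ = _ := by rw [ENNReal.tsum_mul_left, sq, mul_assoc]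

variable [DecidableEq α]

theorem card_finsetWalkLength_succ (n : ℕ) (u v : α) :
    (H.finsetWalkLength (n + 1) u v).card =
      ∑ w ∈ H.neighborFinset u, (H.finsetWalkLength n w v).card := by
  rw [finsetWalkLength, Finset.card_biUnion]
  · refine (Finset.sum_congr rfl fun w _ ↦ Finset.card_map _).trans ?_
    exact (Finset.sum_subtype (H.neighborFinset u) (p := (· ∈ H.neighborSet u)) (fun w ↦ by simp)
      fun w ↦ (H.finsetWalkLength n w v).card).symm
  · intro w _ w' _ hne
    rw [Function.onFun, Finset.disjoint_left]
    intro p hp hp'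
    obtain ⟨q, -, rfl⟩ := Finset.mem_map.1 hp
    obtain ⟨q', -, h⟩ := Finset.mem_map.1 hp'
    exact hne (Subtype.ext (Walk.cons.inj h).1.symm)

theorem card_finsetWalkLength_comm (n : ℕ) (u v : α) :
    (H.finsetWalkLength n u v).card = (H.finsetWalkLength n v u).card :=
  Finset.card_bij' (fun p _ ↦ p.reverse) (fun p _ ↦ p.reverse)
    (by simp [mem_finsetWalkLength_iff]) (by simp [mem_finsetWalkLength_iff])
    (by simp) (by simp)

theorem card_finsetWalkLength_add (m n : ℕ) (u v : α) :
    ((H.finsetWalkLength (m + n) u v).card : ℝ≥0∞) =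
      ∑' w, ((H.finsetWalkLength m u w).card : ℝ≥0∞) * (H.finsetWalkLength n w v).card := by
  induction m generalizing u with
  | zero =>
    rw [tsum_eq_single u, zero_add]
    · simp [finsetWalkLength]
    · intro w hw
      simp [finsetWalkLength, hw.symm]
  | succ m ih =>
    simp only [Nat.add_right_comm m 1 n, card_finsetWalkLength_succ, Nat.cast_sum, ih,
      Finset.sum_mul]
    exact (Summable.tsum_finsetSum fun _ _ ↦ ENNReal.summable).symm

theorem card_finsetWalkLength_add_self (n : ℕ) (x : α) :
    ((H.finsetWalkLength (n + n) x x).card : ℝ≥0∞) =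
      ∑' u, ((H.finsetWalkLength n u x).card : ℝ≥0∞) ^ 2 := by
  rw [card_finsetWalkLength_add]
  exact tsum_congr fun u ↦ by rw [H.card_finsetWalkLength_comm n x u, sq]

end SimpleGraph

theorem numClosedWalks_two_mul_succ_le {α : Type*} [DecidableEq α] (H : SimpleGraph α)
    [LocallyFinite H] {Δ : ℕ} (hdeg : ∀ v, H.degree v ≤ Δ) (x : α) (n : ℕ) :
    numClosedWalks H x (2 * (n + 1)) ≤ Δ ^ 2 * numClosedWalks H x (2 * n) := by
  have h := H.tsum_sq_sum_neighborFinset_le hdeg fun w ↦ (H.finsetWalkLength n w x).card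
  simp only [← card_finsetWalkLength_succ, ← card_finsetWalkLength_add_self] at h
  rw [numClosedWalks, numClosedWalks, two_mul, two_mul]
  exact_mod_cast h

theorem numClosedWalks_two_mul_add_le {α : Type*} [DecidableEq α] (H : SimpleGraph α)
    [LocallyFinite H] {Δ : ℕ} (hdeg : ∀ v, H.degree v ≤ Δ) (x : α) (k d : ℕ) :
    numClosedWalks H x (2 * (k + d)) ≤ Δ ^ (2 * d) * numClosedWalks H x (2 * k) := by
  induction d with
  | zero => simp
  | succ d ih =>
    calc
      _ ≤ Δ ^ 2 * numClosedWalks H x (2 * (k + d)) :=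
        numClosedWalks_two_mul_succ_le H hdeg x (k + d)
      _ ≤ Δ ^ 2 * (Δ ^ (2 * d) * numClosedWalks H x (2 * k)) := Nat.mul_le_mul_left _ ih
      _ = _ := by ring

theorem numClosedWalks_le_add_two_mul_length {α : Type*} [DecidableEq α] (H : SimpleGraph α)
    [LocallyFinite H] {x y : α} (p : H.Walk x y) (n : ℕ) :
    numClosedWalks H y n ≤ numClosedWalks H x (n + 2 * p.length) := by
  refine Finset.card_le_card_of_injOn (fun q ↦ p.append (q.append p.reverse)) ?_ ?_
  · intro q hq
    simp only [Finset.mem_coe, mem_finsetWalkLength_iff, Walk.length_append,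
      Walk.length_reverse] at hq ⊢
    omega
  · intro q _ q' _ h
    exact Walk.append_left_injective _ (Walk.append_right_injective _ h)

theorem numClosedWalks_le_of_dist {α : Type*} [DecidableEq α]
    (H : SimpleGraph α) [LocallyFinite H] (hconn : H.Connected)
    (Δ : ℕ) (hdeg : ∀ v, H.degree v ≤ Δ)
    (x y : α) (d : ℕ) (hd : H.dist x y = d) (k : ℕ) :
    numClosedWalks H y (2 * k) ≤ Δ ^ (2 * d) * numClosedWalks H x (2 * k) := by
  obtain ⟨p, hp⟩ := hconn.exists_walk_length_eq_dist x y
  have h := numClosedWalks_le_add_two_mul_length H p (2 * k)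
  rw [hp, hd, ← mul_add] at h
  exact h.trans (numClosedWalks_two_mul_add_le H hdeg x k d)
end

section
/- Let π : T → G be a covering map between simple graphs, let v̂ be a vertex of T, and let w be a walk in G of length k starting at π(v̂). Then there exists a unique walk ŵ in T of length k starting at v̂ whose image under π is w (unique path lifting). -/
open SimpleGraph

namespace IsGraphCover

variable {α β : Type*} {T : SimpleGraph α} {G : SimpleGraph β} {π : T →g G}

theorem exists_walk_lift (hπ : IsGraphCover π) {a u : β} (w : G.Walk a u) (v : α)
    (hv : π v = a) :
    ∃ (t : α) (p : T.Walk v t) (h : π t = u), (p.map π).copy hv h = w := by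
  induction w generalizing v with
  | nil =>
    subst hv
    exact ⟨v, .nil, rfl, rfl⟩
  | cons hadj w ih =>
    subst hv
    obtain ⟨b, hb, rfl⟩ := (hπ v).surjOn hadj
    obtain ⟨t, p, rfl, rfl⟩ := ih b rfl
    exact ⟨t, .cons hb p, rfl, rfl⟩

theorem walk_lift_unique (hπ : IsGraphCover π) {v t t' : α} (p : T.Walk v t)
    (q : T.Walk v t') (h : π t = π t') (hpq : (p.map π).copy rfl h = q.map π) :
    (⟨t, p⟩ : (t : α) × T.Walk v t) = ⟨t', q⟩ := by
  induction p generalizing t' with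
  | nil =>
    cases q with
    | nil => rfl
    | cons hq q => simpa using congrArg Walk.length hpq
  | cons hp p ih =>
    cases q with
    | nil => simpa using congrArg Walk.length hpq
    | cons hq q =>
      simp only [Walk.map_cons, Walk.copy_cons, Walk.cons.injEq] at hpq
      obtain ⟨hb, hw⟩ := hpq
      obtain rfl := (hπ _).injOn hp hq hb
      cases ih q h (eq_of_heq hw)
      rfl

end IsGraphCover

/-- Unique path lifting: a walk of length `k` in `G` starting at `π v̂` lifts to a unique
walk of length `k` in `T` starting at `v̂`. -/
theorem cover_unique_walk_lift {α β : Type*} {T : SimpleGraph α} {G : SimpleGraph β}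
    (π : T →g G) (hπ : IsGraphCover π) (vhat : α) (k : ℕ) (u : β)
    (w : G.Walk (π vhat) u) (hw : w.length = k) :
    ∃! p : (t : α) × T.Walk vhat t,
      p.2.length = k ∧ ∃ h : π p.1 = u, (p.2.map π).copy rfl h = w := by
  obtain ⟨t, p, rfl, rfl⟩ := hπ.exists_walk_lift w vhat rfl
  refine ⟨⟨t, p⟩, ⟨by simpa using hw, rfl, rfl⟩, ?_⟩
  rintro ⟨t', q⟩ ⟨-, h, hq⟩
  exact hπ.walk_lift_unique q p h hq
end

section
/- Let G be a finite connected simple graph in which every vertex has degree at least 2 and at least one vertex has degree at least 3. Then there exists a function Γ assigning to each ordered pair (u,v) of adjacent vertices a real number with 1 ≤ Γ(u,v) < 2, such that for every ordered pair (u,v) of adjacent vertices, ∑_{w ∈ N(v), w ≠ u} Γ(v,w) > Γ(u,v), where N(v) denotes the set of neighbors of v. -/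
open SimpleGraph

/-- A vertex of degree two has no three distinct neighbors. -/
lemma eq_of_degree_eq_two {α : Type*} [Fintype α] [DecidableEq α]
    (G : SimpleGraph α) [DecidableRel G.Adj] {v a b c : α} (hv : G.degree v = 2)
    (ha : G.Adj v a) (hb : G.Adj v b) (hc : G.Adj v c) (hac : a ≠ c) (hbc : b ≠ c) :
    a = b := by
  by_contra hab
  have hsub : ({a, b, c} : Finset α) ⊆ G.neighborFinset v := by
    intro x hx
    simp only [Finset.mem_insert, Finset.mem_singleton] at hx
    rcases hx with rfl | rfl | rfl <;> simpa
  have hle := Finset.card_le_card hsub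
  rw [Finset.card_eq_three.2 ⟨a, b, c, hab, hac, hbc, rfl⟩, card_neighborFinset_eq_degree] at hle
  omega

/-- In a connected graph, a nonempty set of vertices closed under adjacency is everything. -/
lemma mem_of_connected_of_adj_closed {α : Type*} {G : SimpleGraph α} (hconn : G.Connected)
    {S : Set α} (hS : S.Nonempty) (hclosed : ∀ v ∈ S, ∀ w, G.Adj v w → w ∈ S) (x : α) :
    x ∈ S := by
  obtain ⟨v, hv⟩ := hS
  obtain ⟨p⟩ := hconn.preconnected v x
  induction p with
  | nil => exact hv
  | cons h _ ih => exact ih (hclosed _ hv _ h)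

/-- A non-backtracking walk eventually reaches a vertex of degree other than two. -/
lemma exists_iterate_degree_ne_two {α : Type*} [Fintype α] [DecidableEq α]
    (G : SimpleGraph α) [DecidableRel G.Adj] (hconn : G.Connected)
    (hdeg : ∃ v, G.degree v ≠ 2) (next : α → α → α)
    (hnext : ∀ u v, G.Adj v (next u v) ∧ next u v ≠ u) {u v : α} (huv : G.Adj u v) :
    ∃ n, G.degree ((fun p : α × α => (p.2, next p.1 p.2))^[n] (u, v)).2 ≠ 2 := by
  set f : α × α → α × α := fun p => (p.2, next p.1 p.2) with hf
  by_contra! hbad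
  let B : Set (α × α) := {p | G.Adj p.1 p.2 ∧ ∀ n, G.degree (f^[n] p).2 = 2}
  have hdegB : ∀ p ∈ B, G.degree p.2 = 2 := fun p hp => hp.2 0
  have hmaps : Set.MapsTo f B B := fun p hp => ⟨(hnext _ _).1, fun n => hp.2 (n + 1)⟩
  have hinj : Set.InjOn f B := by
    rintro ⟨a, b⟩ hp ⟨c, d⟩ hq h
    simp only [hf, Prod.mk.injEq] at h
    obtain ⟨rfl, h⟩ := h
    have hac : a = c := eq_of_degree_eq_two G (hdegB _ hp) hp.1.symm hq.1.symm (hnext a b).1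
      (hnext a b).2.symm (h ▸ (hnext c b).2.symm)
    rw [hac]
  have hsurj : Set.SurjOn f B B :=
    ((Set.Finite.injOn_iff_bijOn_of_mapsTo (Set.toFinite B) hmaps).1 hinj).surjOn
  obtain ⟨x, hx⟩ := hdeg
  have hxS : x ∈ Prod.snd '' B := by
    have huvB : (u, v) ∈ B := ⟨huv, hbad⟩
    refine mem_of_connected_of_adj_closed hconn ⟨v, Set.mem_image_of_mem _ huvB⟩ ?_ x
    rintro _ ⟨⟨a, b⟩, hp, rfl⟩ w hw
    by_cases hwa : w = a
    · obtain ⟨q, hq, hqp⟩ := hsurj hp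
      exact ⟨q, hq, by rw [hwa]; exact congrArg Prod.fst hqp⟩
    · have hwn := eq_of_degree_eq_two G (hdegB _ hp) hw (hnext a b).1 hp.1.symm hwa (hnext a b).2
      exact ⟨f (a, b), hmaps hp, hwn.symm⟩
  obtain ⟨p, hp, rfl⟩ := hxS
  exact hx (hdegB p hp)

/-- Directed edges can be ranked so that the rank drops when passing through a vertex of degree
two. -/
lemma exists_rank_lt_of_degree_eq_two {α : Type*} [Fintype α] [DecidableEq α]
    (G : SimpleGraph α) [DecidableRel G.Adj] (hconn : G.Connected)
    (hdeg2 : ∀ v, 2 ≤ G.degree v) (hdeg : ∃ v, G.degree v ≠ 2) :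
    ∃ r : α → α → ℕ, ∀ u v w, G.Adj u v → G.degree v = 2 → G.Adj v w → w ≠ u →
      r v w < r u v := by
  have hex : ∀ u v, ∃ w, G.Adj v w ∧ w ≠ u := by
    intro u v
    have hcard : 1 < (G.neighborFinset v).card := hdeg2 v
    obtain ⟨w, hw, hwu⟩ := Finset.exists_mem_ne hcard u
    exact ⟨w, by simpa using hw, hwu⟩
  choose next hnext using hex
  have hreach := fun u v (huv : G.Adj u v) =>
    exists_iterate_degree_ne_two G hconn hdeg next hnext huv
  refine ⟨fun u v => if huv : G.Adj u v then Nat.find (hreach u v huv) else 0, ?_⟩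
  intro u v w huv hv hvw hwu
  obtain rfl : w = next u v :=
    eq_of_degree_eq_two G hv hvw (hnext u v).1 huv.symm hwu (hnext u v).2
  simp only [huv, hvw, dif_pos]
  have hspec := Nat.find_spec (hreach u v huv)
  rcases hk : Nat.find (hreach u v huv) with _ | k
  · rw [hk] at hspec
    exact absurd hv hspec
  · rw [hk, Function.iterate_succ_apply] at hspec
    exact Nat.lt_succ_of_le (Nat.find_min' _ hspec)

theorem exists_gamma_on_directed_edges {α : Type*} [Fintype α] [DecidableEq α]
    (G : SimpleGraph α) [DecidableRel G.Adj] (hconn : G.Connected)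
    (hdeg2 : ∀ v, 2 ≤ G.degree v) (hdeg3 : ∃ v, 3 ≤ G.degree v) :
    ∃ Γ : α → α → ℝ,
      (∀ u v, G.Adj u v → 1 ≤ Γ u v ∧ Γ u v < 2) ∧
      ∀ u v, G.Adj u v → Γ u v < ∑ w ∈ (G.neighborFinset v).erase u, Γ v w := by
  obtain ⟨r, hr⟩ := exists_rank_lt_of_degree_eq_two G hconn hdeg2
    (hdeg3.imp fun v hv => by omega)
  have hlower : ∀ u v, (1 : ℝ) ≤ 1 + 1 / (r u v + 2) := fun u v =>
    le_add_of_nonneg_right (by positivity)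
  have hupper : ∀ u v, 1 + 1 / ((r u v : ℝ) + 2) < 2 := by
    intro u v
    have h : 1 / ((r u v : ℝ) + 2) < 1 := by
      rw [div_lt_one (by positivity)]
      linarith [(r u v).cast_nonneg (α := ℝ)]
    linarith
  refine ⟨fun u v => 1 + 1 / (r u v + 2), fun u v _ => ⟨hlower u v, hupper u v⟩, ?_⟩
  intro u v huv
  have hcard : ((G.neighborFinset v).erase u).card = G.degree v - 1 := by
    rw [Finset.card_erase_of_mem (by simpa using huv.symm), card_neighborFinset_eq_degree]
  rcases (hdeg2 v).eq_or_lt with hv | hv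
  · obtain ⟨w, hw⟩ := Finset.card_eq_one.1 (hcard.trans (by omega))
    have hmem : w ∈ (G.neighborFinset v).erase u := by simp [hw]
    rw [Finset.mem_erase, mem_neighborFinset] at hmem
    have hlt : (r v w : ℝ) < r u v := by exact_mod_cast hr u v w huv hv.symm hmem.2 hmem.1
    rw [hw, Finset.sum_singleton]
    beta_reduce
    gcongr
  · have hsum := Finset.card_nsmul_le_sum ((G.neighborFinset v).erase u)
      (fun w => 1 + 1 / ((r v w : ℝ) + 2)) 1 fun w _ => hlower v w
    have htwo : (2 : ℝ) ≤ ((G.neighborFinset v).erase u).card := by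
      exact_mod_cast (by omega : 2 ≤ ((G.neighborFinset v).erase u).card)
    rw [nsmul_one] at hsum
    exact (hupper u v).trans_le (htwo.trans hsum)
end

section
/- Let π : T → G be a covering map from a tree T to a simple graph G, let v̂ be a vertex of T and set v = π(v̂). If for some r ≥ 0 the ball B_r(G,v) (the subgraph of G induced on the vertices at distance at most r from v) contains no cycle, then π restricts to a graph isomorphism from the induced subgraph B_r(T,v̂) onto the induced subgraph B_r(G,v). -/
open SimpleGraph

/-- A locally injective homomorphism maps paths to walks without backtracking. -/
theorem isChain_edges_map_of_injOn_neighborSet {α β : Type*} {H : SimpleGraph α}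
    {K : SimpleGraph β} (f : H →g K) (hf : ∀ v, Set.InjOn f (H.neighborSet v)) {u v : α}
    {p : H.Walk u v} (hp : p.IsPath) : List.IsChain (· ≠ ·) (p.map f).edges := by
  induction p with
  | nil => simp
  | @cons u v w h p ih =>
    rw [Walk.cons_isPath_iff] at hp
    cases p with
    | nil => simp
    | @cons _ x _ h' q =>
      have hchain := ih hp.1
      simp only [Walk.map_cons, Walk.edges_cons, List.isChain_cons_cons] at hchain ⊢
      refine ⟨fun he ↦ ?_, hchain⟩
      have hux : u ≠ x := by
        rintro rfl
        exact hp.2 (by simp)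
      rw [Sym2.eq_swap, Sym2.congr_right] at he
      exact hux (hf v h.symm h' he)

/-- A locally injective homomorphism to an acyclic graph maps paths to paths. -/
theorem isPath_map_of_injOn_neighborSet {α β : Type*} {H : SimpleGraph α}
    {K : SimpleGraph β} (hK : K.IsAcyclic) (f : H →g K)
    (hf : ∀ v, Set.InjOn f (H.neighborSet v)) {u v : α} {p : H.Walk u v} (hp : p.IsPath) :
    (p.map f).IsPath :=
  (hK.isPath_iff_isChain _).2 (isChain_edges_map_of_injOn_neighborSet f hf hp)

/-- A locally injective homomorphism from a preconnected graph to an acyclic graph is injective. -/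
theorem injective_of_injOn_neighborSet {α β : Type*} {H : SimpleGraph α} {K : SimpleGraph β}
    (hH : H.Preconnected) (hK : K.IsAcyclic) (f : H →g K)
    (hf : ∀ v, Set.InjOn f (H.neighborSet v)) : Function.Injective f := by
  intro u w huw
  obtain ⟨p, hp⟩ := (hH u w).exists_isPath
  have hq := isPath_map_of_injOn_neighborSet hK f hf hp
  have heq := (hK.subsingleton_path (f u) (f u)).elim
    ⟨(p.map f).copy rfl huw.symm, (Walk.isPath_copy _ _ _).2 hq⟩ Path.nil
  have hlen := congrArg (fun q : K.Path (f u) (f u) ↦ q.1.length) heq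
  simp only [Walk.length_copy, Walk.length_map, Path.nil_coe, Walk.length_nil] at hlen
  exact Walk.eq_of_length_eq_zero hlen

/-- A locally injective homomorphism from a preconnected graph to an acyclic graph reflects
adjacency. -/
theorem adj_of_map_adj_of_injOn_neighborSet {α β : Type*} {H : SimpleGraph α}
    {K : SimpleGraph β} (hH : H.Preconnected) (hK : K.IsAcyclic) (f : H →g K)
    (hf : ∀ v, Set.InjOn f (H.neighborSet v)) {u w : α} (huw : K.Adj (f u) (f w)) :
    H.Adj u w := by
  obtain ⟨p, hp⟩ := (hH u w).exists_isPath
  have heq := (hK.subsingleton_path (f u) (f w)).elim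
    ⟨_, isPath_map_of_injOn_neighborSet hK f hf hp⟩ (Path.singleton huw)
  have hlen := congrArg (fun q : K.Path (f u) (f w) ↦ q.1.length) heq
  simp only [Walk.length_map] at hlen
  exact Walk.adj_of_length_eq_one hlen

/-- Balls in a connected graph are connected. -/
theorem preconnected_induce_ball {α : Type*} {T : SimpleGraph α} (hT : T.Connected) (v : α)
    (r : ℕ) : (T.induce {u : α | T.dist v u ≤ r}).Preconnected := by
  classical
  have key : ∀ u : {u : α | T.dist v u ≤ r},
      (T.induce {u : α | T.dist v u ≤ r}).Reachable ⟨v, by simp⟩ u := by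
    rintro ⟨u, hu⟩
    obtain ⟨p, hp⟩ := hT.exists_walk_length_eq_dist v u
    have hmem : ∀ x ∈ p.support, x ∈ {u : α | T.dist v u ≤ r} := fun x hx ↦
      (dist_le (p.takeUntil x hx)).trans <|
        (p.length_takeUntil_le_length hx).trans (hp.le.trans hu)
    exact ⟨p.induce _ hmem⟩
  exact fun u w ↦ (key u).symm.trans (key w)

/-- Walks lift along a graph cover. -/
theorem IsGraphCover.exists_lift {α β : Type*} {T : SimpleGraph α} {G : SimpleGraph β}
    {π : T →g G} (hπ : IsGraphCover π) {x y : β} (p : G.Walk x y) :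
    ∀ a, π a = x → ∃ (b : α) (q : T.Walk a b), π b = y ∧ q.length = p.length := by
  induction p with
  | nil => exact fun a ha ↦ ⟨a, .nil, ha, rfl⟩
  | cons h p ih =>
    rintro a rfl
    obtain ⟨c, hc, hcv⟩ := (hπ a).surjOn h
    obtain ⟨b, q, hb, hq⟩ := ih c hcv
    exact ⟨b, .cons hc q, hb, congrArg (· + 1) hq⟩

theorem cover_restricts_to_ball_iso {α β : Type*} {T : SimpleGraph α} {G : SimpleGraph β}
    (hT : T.IsTree) (π : T →g G) (hπ : IsGraphCover π) (vhat : α) (r : ℕ)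
    (hacyc : (G.induce {u : β | G.Reachable (π vhat) u ∧ G.dist (π vhat) u ≤ r}).IsAcyclic) :
    ∃ φ : (T.induce {u : α | T.dist vhat u ≤ r}) ≃g
        (G.induce {u : β | G.Reachable (π vhat) u ∧ G.dist (π vhat) u ≤ r}),
      ∀ u, (φ u : β) = π u := by
  have hmaps : ∀ u, T.dist vhat u ≤ r →
      G.Reachable (π vhat) (π u) ∧ G.dist (π vhat) (π u) ≤ r := by
    intro u hu
    obtain ⟨p, hp⟩ := hT.connected.exists_walk_length_eq_dist vhat u
    exact ⟨⟨p.map π⟩, (dist_le (p.map π)).trans (by simpa [hp] using hu)⟩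
  let f : (T.induce {u : α | T.dist vhat u ≤ r}) →g
      (G.induce {u : β | G.Reachable (π vhat) u ∧ G.dist (π vhat) u ≤ r}) :=
    { toFun := fun u ↦ ⟨π u, hmaps u u.2⟩
      map_rel' := fun h ↦ π.map_adj h }
  have hf : ∀ v, Set.InjOn f ((T.induce {u : α | T.dist vhat u ≤ r}).neighborSet v) :=
    fun v a ha b hb hab ↦ Subtype.ext ((hπ v).injOn ha hb (congrArg Subtype.val hab))
  have hpre := preconnected_induce_ball hT.connected vhat r
  have hsurj : Function.Surjective f := by
    rintro ⟨y, hy, hyr⟩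
    obtain ⟨p, hp⟩ := hy.exists_walk_length_eq_dist
    obtain ⟨b, q, rfl, hq⟩ := hπ.exists_lift p vhat rfl
    exact ⟨⟨b, (dist_le q).trans (by rw [hq, hp]; exact hyr)⟩, rfl⟩
  exact ⟨{ Equiv.ofBijective f ⟨injective_of_injOn_neighborSet hpre hacyc f hf, hsurj⟩ with
      map_rel_iff' := ⟨adj_of_map_adj_of_injOn_neighborSet hpre hacyc f hf, f.map_adj⟩ },
    fun _ ↦ rfl⟩
end
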